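/- For every p with 1 ≤ p ≤ 2 there is a constant C (depending only on d, p, and β_0) such that for all k ∈ ℤ, all j ≥ 10, all t ∈ [2^k, 2^{k+1}], and every Schwartz function f on ℝ^d: ‖A_t^j f‖_{L^p} + 2^{k−j} ‖B_t^j f‖_{L^p} ≤ C 2^{−j(d−1)/p'} ‖f‖_{L^p}, where p' = p/(p−1). -/

import Mathlib

open MeasureTheory Metric Set Filter
open scoped ENNReal NNReal Topology RealInnerProductSpace

noncomputable section

abbrev Ed (d : ℕ) := EuclideanSpace ℝ (Fin d)

/-- The rotation-invariant probability measure on the unit sphere. -/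
def sphereProb (d : ℕ) : Measure (sphere (0 : Ed d) 1) :=
  ((volume : Measure (Ed d)).toSphere Set.univ)⁻¹ • (volume : Measure (Ed d)).toSphere

def eChar (r : ℝ) : ℂ := Complex.exp ((r : ℂ) * Complex.I)

/-- The Fourier transform `\widehat{dσ}` of the sphere measure. -/
def sigmaHat (d : ℕ) (ξ : Ed d) : ℂ :=
  ∫ y : sphere (0 : Ed d) 1, eChar (-(2 * Real.pi * ⟪ξ, (y : Ed d)⟫)) ∂(sphereProb d)

/-- The Fourier transform `\hat f`. -/
def fourierInt (d : ℕ) (f : Ed d → ℂ) (ξ : Ed d) : ℂ :=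
  ∫ x : Ed d, eChar (-(2 * Real.pi * ⟪ξ, x⟫)) * f x

/-- `β₀ ∈ C_c^∞` is radial, `≡ 1` on `{|ξ| ≤ 1}` and `≡ 0` on `{|ξ| ≥ 2}`. -/
def IsAdmissibleBump (d : ℕ) (β0 : Ed d → ℝ) : Prop :=
  ContDiff ℝ (⊤ : ℕ∞) β0 ∧ HasCompactSupport β0 ∧
  (∀ ξ η : Ed d, ‖ξ‖ = ‖η‖ → β0 ξ = β0 η) ∧
  (∀ ξ : Ed d, ‖ξ‖ ≤ 1 → β0 ξ = 1) ∧ (∀ ξ : Ed d, 2 ≤ ‖ξ‖ → β0 ξ = 0)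

/-- `β_j(ξ) = β₀(2^{-j} ξ) - β₀(2^{1-j} ξ)`. -/
def betaJ (d : ℕ) (β0 : Ed d → ℝ) (j : ℕ) (ξ : Ed d) : ℝ :=
  β0 ((2:ℝ) ^ (-(j:ℤ)) • ξ) - β0 ((2:ℝ) ^ (1 - (j:ℤ)) • ξ)

/-- The frequency-localized spherical mean `A_t^j f`, defined via the Fourier
multiplier `\widehat{dσ}(tξ) β_j(tξ)`. -/
def Aj (d : ℕ) (β0 : Ed d → ℝ) (j : ℕ) (t : ℝ) (f : Ed d → ℂ) (x : Ed d) : ℂ :=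
  ∫ ξ : Ed d, eChar (2 * Real.pi * ⟪ξ, x⟫) *
    (sigmaHat d (t • ξ) * (betaJ d β0 j (t • ξ) : ℂ) * fourierInt d f ξ)

/-- `B_t^j f = (∂/∂t) A_t^j f`. -/
def Bj (d : ℕ) (β0 : Ed d → ℝ) (j : ℕ) (t : ℝ) (f : Ed d → ℂ) (x : Ed d) : ℂ :=
  deriv (fun s : ℝ => Aj d β0 j s f x) t

theorem lintegral_Ioo_ofReal_rpow {q c : ℝ} (hq : -1 < q) (hc : 0 ≤ c) :
    ∫⁻ t in Ioo 0 c, ENNReal.ofReal (t ^ q) = ENNReal.ofReal (c ^ (q + 1) / (q + 1)) := by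
  have hint : IntegrableOn (fun t : ℝ => t ^ q) (Ioc 0 c) :=
    (intervalIntegrable_iff_integrableOn_Ioc_of_le hc).1 (intervalIntegral.intervalIntegrable_rpow' hq)
  rw [setLIntegral_congr Ioo_ae_eq_Ioc, ← ofReal_integral_eq_lintegral_ofReal hint,
    ← intervalIntegral.integral_of_le hc, integral_rpow (Or.inl hq),
    Real.zero_rpow (by linarith), sub_zero]
  filter_upwards [ae_restrict_mem measurableSet_Ioc] with t ht using Real.rpow_nonneg ht.1.le _

theorem lintegral_Ici_ofReal_rpow {q c : ℝ} (hq : q < -1) (hc : 0 < c) :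
    ∫⁻ t in Ici c, ENNReal.ofReal (t ^ q) = ENNReal.ofReal (c ^ (q + 1) / (-(q + 1))) := by
  rw [setLIntegral_congr Ioi_ae_eq_Ici.symm,
    ← ofReal_integral_eq_lintegral_ofReal (integrableOn_Ioi_rpow_of_lt hq hc),
    integral_Ioi_rpow_of_lt hq hc, neg_div, div_neg]
  filter_upwards [ae_restrict_mem measurableSet_Ioi] with t ht using
    Real.rpow_nonneg (hc.trans ht).le _

/-- The real-interpolation step between weak type `(1,1)` and weak type `(2,2)`, for the height
splitting of `u` at level `s * t`. -/
theorem lintegral_rpow_le_of_meas_lt_le {α : Type*} [MeasurableSpace α] {μ : Measure α} [SFinite μ]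
    {u v : α → ℝ} (hu : Measurable u) (hu0 : ∀ x, 0 ≤ u x) (hv : Measurable v) (hv0 : ∀ x, 0 ≤ v x)
    {p s : ℝ} (hp1 : 1 < p) (hp2 : p < 2) (hs : 0 < s) {a b : ℝ≥0∞}
    (h : ∀ t : ℝ, 0 < t → μ {x | t < v x} ≤
      ENNReal.ofReal t⁻¹ * (a * ∫⁻ x in {x | s * t < u x}, ENNReal.ofReal (u x) ∂μ) +
      ENNReal.ofReal (t⁻¹ ^ 2) * (b * ∫⁻ x in {x | u x ≤ s * t}, ENNReal.ofReal (u x ^ 2) ∂μ)) :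
    ∫⁻ x, ENNReal.ofReal (v x ^ p) ∂μ ≤
      ENNReal.ofReal p * (a * ENNReal.ofReal (s ^ (1 - p) / (p - 1)) +
        b * ENNReal.ofReal (s ^ (2 - p) / (2 - p))) * ∫⁻ x, ENNReal.ofReal (u x ^ p) ∂μ := by
  rw [lintegral_rpow_eq_lintegral_meas_lt_mul μ (Eventually.of_forall hv0) hv.aemeasurable
    (by linarith), mul_assoc]
  gcongr
  have hm1 : MeasurableSet {z : ℝ × α | s * z.1 < u z.2} :=
    measurableSet_lt (by fun_prop) (by fun_prop)
  have hm2 : MeasurableSet {z : ℝ × α | u z.2 ≤ s * z.1} :=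
    measurableSet_le (by fun_prop) (by fun_prop)
  have hf1 : Measurable (fun z : ℝ × α => ENNReal.ofReal (z.1 ^ (p - 2)) *
      {z : ℝ × α | s * z.1 < u z.2}.indicator (fun z => ENNReal.ofReal (u z.2)) z) :=
    Measurable.mul (by fun_prop) (Measurable.indicator (by fun_prop) hm1)
  have hf2 : Measurable (fun z : ℝ × α => ENNReal.ofReal (z.1 ^ (p - 3)) *
      {z : ℝ × α | u z.2 ≤ s * z.1}.indicator (fun z => ENNReal.ofReal (u z.2 ^ 2)) z) :=
    Measurable.mul (by fun_prop) (Measurable.indicator (by fun_prop) hm2)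
  calc ∫⁻ t in Ioi 0, μ {x | t < v x} * ENNReal.ofReal (t ^ (p - 1))
      ≤ ∫⁻ t in Ioi 0, (a * ∫⁻ x, ENNReal.ofReal (t ^ (p - 2)) *
          {z : ℝ × α | s * z.1 < u z.2}.indicator (fun z => ENNReal.ofReal (u z.2)) (t, x) ∂μ) +
          b * ∫⁻ x, ENNReal.ofReal (t ^ (p - 3)) *
          {z : ℝ × α | u z.2 ≤ s * z.1}.indicator (fun z => ENNReal.ofReal (u z.2 ^ 2)) (t, x) ∂μ := by
        refine setLIntegral_mono' measurableSet_Ioi fun t (ht : 0 < t) => ?_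
        have e1 : ENNReal.ofReal (t ^ (p - 2)) = ENNReal.ofReal t⁻¹ * ENNReal.ofReal (t ^ (p - 1)) := by
          rw [← ENNReal.ofReal_mul (by positivity), ← Real.rpow_neg_one, ← Real.rpow_add ht]
          ring_nf
        have e2 : ENNReal.ofReal (t ^ (p - 3)) =
            ENNReal.ofReal (t⁻¹ ^ 2) * ENNReal.ofReal (t ^ (p - 1)) := by
          rw [← ENNReal.ofReal_mul (by positivity), inv_pow, ← Real.rpow_natCast,
            ← Real.rpow_neg ht.le, ← Real.rpow_add ht]
          norm_num
          ring_nf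
        have i1 : ∫⁻ x in {x | s * t < u x}, ENNReal.ofReal (u x) ∂μ =
            ∫⁻ x, {z : ℝ × α | s * z.1 < u z.2}.indicator
              (fun z => ENNReal.ofReal (u z.2)) (t, x) ∂μ := by
          rw [← lintegral_indicator (measurableSet_lt (by fun_prop) (by fun_prop))]
          rfl
        have i2 : ∫⁻ x in {x | u x ≤ s * t}, ENNReal.ofReal (u x ^ 2) ∂μ =
            ∫⁻ x, {z : ℝ × α | u z.2 ≤ s * z.1}.indicator
              (fun z => ENNReal.ofReal (u z.2 ^ 2)) (t, x) ∂μ := by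
          rw [← lintegral_indicator (measurableSet_le (by fun_prop) (by fun_prop))]
          rfl
        rw [lintegral_const_mul' _ _ ENNReal.ofReal_ne_top,
          lintegral_const_mul' _ _ ENNReal.ofReal_ne_top, ← i1, ← i2, e1, e2]
        refine (mul_le_mul_left (h t ht) _).trans (le_of_eq ?_)
        ring
    _ = a * (∫⁻ x, (∫⁻ t in Ioi 0, ENNReal.ofReal (t ^ (p - 2)) *
          {z : ℝ × α | s * z.1 < u z.2}.indicator (fun z => ENNReal.ofReal (u z.2)) (t, x)) ∂μ) +
        b * (∫⁻ x, (∫⁻ t in Ioi 0, ENNReal.ofReal (t ^ (p - 3)) *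
          {z : ℝ × α | u z.2 ≤ s * z.1}.indicator
            (fun z => ENNReal.ofReal (u z.2 ^ 2)) (t, x)) ∂μ) := by
        rw [lintegral_add_left (hf1.lintegral_prod_right'.const_mul a),
          lintegral_const_mul _ hf1.lintegral_prod_right',
          lintegral_const_mul _ hf2.lintegral_prod_right']
        congr 2
        · exact lintegral_lintegral_swap hf1.aemeasurable
        · exact lintegral_lintegral_swap hf2.aemeasurable
    _ ≤ a * (∫⁻ x, ENNReal.ofReal (s ^ (1 - p) / (p - 1)) * ENNReal.ofReal (u x ^ p) ∂μ) +
        b * (∫⁻ x, ENNReal.ofReal (s ^ (2 - p) / (2 - p)) * ENNReal.ofReal (u x ^ p) ∂μ) := by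
        gcongr with x x
        · have : ∀ t ∈ Ioi (0 : ℝ), ENNReal.ofReal (t ^ (p - 2)) *
              {z : ℝ × α | s * z.1 < u z.2}.indicator (fun z => ENNReal.ofReal (u z.2)) (t, x) =
              (Iio (u x / s)).indicator (fun t => ENNReal.ofReal (t ^ (p - 2))) t *
                ENNReal.ofReal (u x) := by
            intro t _
            simp only [indicator, mem_ofPred_eq, mem_Iio, lt_div_iff₀ hs, mul_comm t s]
            split_ifs <;> simp
          rw [setLIntegral_congr_fun measurableSet_Ioi this,
            lintegral_mul_const' _ _ ENNReal.ofReal_ne_top, setLIntegral_indicator measurableSet_Iio,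
            inter_comm, Ioi_inter_Iio, lintegral_Ioo_ofReal_rpow (by linarith) (by have := hu0 x; positivity)]
          rw [← ENNReal.ofReal_mul' (hu0 x), ← ENNReal.ofReal_mul' (Real.rpow_nonneg (hu0 x) _)]
          refine ENNReal.ofReal_le_ofReal (le_of_eq ?_)
          rcases (hu0 x).eq_or_lt with h0 | h0
          · rw [← h0, Real.zero_rpow (by linarith)]; simp
          · rw [Real.div_rpow h0.le hs.le, show p - 2 + 1 = p - 1 by ring,
              show (1 - p) = -(p - 1) by ring, Real.rpow_neg hs.le, Real.rpow_sub_one h0.ne']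
            field_simp
        · rcases (hu0 x).eq_or_lt with h0 | h0
          · simp [indicator, ← h0]
          have : ∀ t ∈ Ioi (0 : ℝ), ENNReal.ofReal (t ^ (p - 3)) *
              {z : ℝ × α | u z.2 ≤ s * z.1}.indicator (fun z => ENNReal.ofReal (u z.2 ^ 2)) (t, x) =
              (Ici (u x / s)).indicator (fun t => ENNReal.ofReal (t ^ (p - 3))) t *
                ENNReal.ofReal (u x ^ 2) := by
            intro t _
            simp only [indicator, mem_ofPred_eq, mem_Ici, div_le_iff₀ hs, mul_comm t s]
            split_ifs <;> simp
          have hc : 0 < u x / s := by positivity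
          rw [setLIntegral_congr_fun measurableSet_Ioi this,
            lintegral_mul_const' _ _ ENNReal.ofReal_ne_top, setLIntegral_indicator measurableSet_Ici,
            inter_eq_left.2 (Ici_subset_Ioi.2 hc), lintegral_Ici_ofReal_rpow (by linarith) hc]
          rw [← ENNReal.ofReal_mul' (by positivity), ← ENNReal.ofReal_mul' (by positivity)]
          refine ENNReal.ofReal_le_ofReal (le_of_eq ?_)
          rw [Real.div_rpow h0.le hs.le, show p - 3 + 1 = p - 2 by ring,
              show (2 - p) = -(p - 2) by ring, Real.rpow_neg hs.le,
              show u x ^ (p - 2) = u x ^ p / u x ^ 2 by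
                rw [Real.rpow_sub h0]; norm_num]
          field_simp
    _ = _ := by
        rw [lintegral_const_mul' _ _ ENNReal.ofReal_ne_top,
          lintegral_const_mul' _ _ ENNReal.ofReal_ne_top]
        ring
section Convolution

open FourierTransform Convolution SchwartzMap

variable {E : Type*} [NormedAddCommGroup E] [InnerProductSpace ℝ E] [FiniteDimensional ℝ E]
  [MeasurableSpace E] [BorelSpace E]

theorem SchwartzMap.eLpNorm_fourier_two (f : 𝓢(E, ℂ)) : eLpNorm (⇑(𝓕 f : 𝓢(E, ℂ))) 2 volume =
    eLpNorm f 2 volume := by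
  have h := norm_fourier_toL2_eq f
  rw [norm_toLp, norm_toLp] at h
  have h1 := ((𝓕 f : 𝓢(E, ℂ)).eLpNorm_lt_top 2 (μ := volume)).ne
  have h2 := (f.eLpNorm_lt_top 2 (μ := volume)).ne
  rwa [ENNReal.toReal_eq_toReal_iff' h1 h2] at h

theorem SchwartzMap.eLpNorm_two_convolution_le (K f : 𝓢(E, ℂ)) {A : ℝ} (hA : ∀ ξ, ‖𝓕 K ξ‖ ≤ A) :
    eLpNorm (K ⋆[.mul ℂ ℂ] f) 2 volume ≤ ENNReal.ofReal A * eLpNorm f 2 volume := by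
  have h : (K ⋆[.mul ℂ ℂ] f) = SchwartzMap.convolution (.mul ℂ ℂ) K f :=
    funext fun x => (SchwartzMap.convolution_apply _ K f x).symm
  rw [h, ← eLpNorm_fourier_two, ← eLpNorm_fourier_two f, fourier_convolution]
  refine eLpNorm_le_mul_eLpNorm_of_ae_le_mul (Eventually.of_forall fun ξ => ?_) 2
  rw [pairing_apply_apply, ContinuousLinearMap.mul_apply', norm_mul]
  gcongr
  exact hA ξ

theorem SchwartzMap.convolution_of_memLp_two_norm_le (K : 𝓢(E, ℂ)) {g : E → ℂ} (hg : MemLp g 2 volume)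
    (x : E) : ConvolutionExistsAt K g x (.mul ℂ ℂ) volume ∧
      ‖(K ⋆[.mul ℂ ℂ] g) x‖ₑ ≤ eLpNorm K 2 volume * eLpNorm g 2 volume := by
  have hmp : MeasurePreserving (fun z : E => x - z) volume volume :=
    Measure.measurePreserving_sub_left volume x
  have hg' : MemLp (fun z => g (x - z)) 2 volume := hg.comp_measurePreserving hmp
  have hn : eLpNorm (fun z => g (x - z)) 2 volume = eLpNorm g 2 volume :=
    eLpNorm_comp_measurePreserving hg.1 hmp
  have hi : Integrable (fun z => K z * g (x - z)) := (K.memLp 2 (μ := volume)).integrable_mul hg'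
  refine ⟨hi, (enorm_integral_le_lintegral_enorm _).trans ?_⟩
  rw [← eLpNorm_one_eq_lintegral_enorm, ← hn]
  have := eLpNorm_le_eLpNorm_mul_eLpNorm_of_nnnorm (p := 2) (q := 2) (r := 1)
    (K.memLp 2 (μ := volume)).1 hg'.1 (fun a b => a * b) 1 (by simp)
  simpa using this

theorem SchwartzMap.eLpNorm_two_convolution_le_of_memLp (K : 𝓢(E, ℂ)) {g : E → ℂ} (hg : MemLp g 2 volume)
    {A : ℝ} (hA : ∀ ξ, ‖𝓕 K ξ‖ ≤ A) :
    eLpNorm (K ⋆[.mul ℂ ℂ] g) 2 volume ≤ ENNReal.ofReal A * eLpNorm g 2 volume := by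
  have : Fact ((1 : ℝ≥0∞) ≤ 2) := ⟨by norm_num⟩
  obtain ⟨u, hu, hlim⟩ := mem_closure_iff_seq_limit.1
    (SchwartzMap.denseRange_toLpCLM (E := E) (F := ℂ) (p := 2) (by simp) (μ := volume) hg.toLp)
  choose f hf using hu
  have hfu : ∀ n, u n = (f n).toLp 2 := fun n => (hf n).symm
  have hlim1 : Tendsto (fun n => eLpNorm (⇑(f n) - g) 2 volume) atTop (𝓝 0) := by
    rw [show u = fun n => ((f n).memLp 2 (μ := volume)).toLp (f n) from funext hfu] at hlim
    exact (Lp.tendsto_Lp_iff_tendsto_eLpNorm'' _ (fun n => (f n).memLp 2) _ hg).1 hlim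
  have hlim2 : Tendsto (fun n => eLpNorm (f n) 2 volume) atTop (𝓝 (eLpNorm g 2 volume)) := by
    refine tendsto_of_tendsto_of_tendsto_of_le_of_le (g := fun n => eLpNorm g 2 volume -
      eLpNorm (⇑(f n) - g) 2 volume) (h := fun n => eLpNorm g 2 volume +
      eLpNorm (⇑(f n) - g) 2 volume) ?_ ?_ (fun n => ?_) (fun n => ?_)
    · simpa using ENNReal.Tendsto.sub tendsto_const_nhds hlim1 (Or.inl hg.eLpNorm_ne_top)
    · simpa using tendsto_const_nhds.add hlim1
    · have := eLpNorm_sub_le (p := 2) ((f n).memLp 2 (μ := volume)).1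
        (((f n).memLp 2 (μ := volume)).1.sub hg.1) (by norm_num)
      rw [sub_sub_cancel] at this
      exact tsub_le_iff_right.2 this
    · have := eLpNorm_add_le (p := 2) hg.1 (((f n).memLp 2 (μ := volume)).1.sub hg.1) (by norm_num)
      rwa [add_sub_cancel] at this
  have hpt : ∀ x, Tendsto (fun n => (K ⋆[.mul ℂ ℂ] (f n)) x) atTop (𝓝 ((K ⋆[.mul ℂ ℂ] g) x)) := by
    intro x
    rw [tendsto_iff_edist_tendsto_0]
    refine tendsto_of_tendsto_of_tendsto_of_le_of_le tendsto_const_nhds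
      (h := fun n => eLpNorm K 2 volume * eLpNorm (⇑(f n) - g) 2 volume) ?_ (fun n => zero_le)
      (fun n => ?_)
    · simpa using ENNReal.Tendsto.const_mul hlim1 (Or.inr (K.memLp 2 (μ := volume)).eLpNorm_ne_top)
    · have hfn : MemLp (f n) 2 volume := (f n).memLp 2
      have h1 := K.convolution_of_memLp_two_norm_le (hfn.sub hg) x
      have h2 := (K.convolution_of_memLp_two_norm_le hg x).1.distrib_add h1.1
      rw [add_sub_cancel] at h2
      dsimp only
      rw [edist_eq_enorm_sub, h2, add_sub_cancel_left]
      exact h1.2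
  refine (Lp.eLpNorm_lim_le_liminf_eLpNorm (f := fun n => (K ⋆[.mul ℂ ℂ] (f n))) (fun n => ?_) _
    (Eventually.of_forall hpt)).trans ?_
  · exact ((K.integrable.integrable_convolution _ (f n).integrable)).1
  · refine (liminf_le_liminf (Eventually.of_forall fun n =>
      K.eLpNorm_two_convolution_le (f n) hA)).trans (le_of_eq ?_)
    exact (ENNReal.Tendsto.const_mul hlim2 (Or.inr ENNReal.ofReal_ne_top)).liminf_eq

theorem eLpNorm_one_convolution_le {K g : E → ℂ} (hK : AEStronglyMeasurable K volume)
    (hg : AEStronglyMeasurable g volume) :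
    eLpNorm (K ⋆[.mul ℂ ℂ] g) 1 volume ≤ eLpNorm K 1 volume * eLpNorm g 1 volume := by
  simp only [eLpNorm_one_eq_lintegral_enorm]
  calc ∫⁻ x, ‖(K ⋆[.mul ℂ ℂ] g) x‖ₑ ≤ ∫⁻ x, ∫⁻ t, ‖K t‖ₑ * ‖g (x - t)‖ₑ := by
        refine lintegral_mono fun x => (enorm_integral_le_lintegral_enorm _).trans (le_of_eq ?_)
        simp
    _ = ∫⁻ t, ∫⁻ x, ‖K t‖ₑ * ‖g (x - t)‖ₑ := by
        refine lintegral_lintegral_swap ?_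
        have h := hK.convolution_integrand (ContinuousLinearMap.mul ℂ ℂ) (μ := volume) (ν := volume) hg
        simpa [Function.uncurry_def] using h.enorm
    _ = ∫⁻ t, ‖K t‖ₑ * ∫⁻ x, ‖g x‖ₑ := by
        refine lintegral_congr fun t => ?_
        rw [lintegral_const_mul' _ _ enorm_ne_top, lintegral_sub_right_eq_self (fun x => ‖g x‖ₑ)]
    _ = _ := lintegral_mul_const'' _ hK.enorm

theorem SchwartzMap.volume_lt_norm_convolution_le (K f : 𝓢(E, ℂ)) {A B : ℝ} (hB0 : 0 ≤ B)
    (hA : eLpNorm K 1 volume ≤ ENNReal.ofReal A) (hB : ∀ ξ, ‖𝓕 K ξ‖ ≤ B) (c : ℝ) {t : ℝ} (ht : 0 < t) :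
    volume {x | t < ‖(K ⋆[.mul ℂ ℂ] f) x‖} ≤
      ENNReal.ofReal t⁻¹ * (ENNReal.ofReal (2 * A) *
        ∫⁻ x in {x | c < ‖f x‖}, ENNReal.ofReal ‖f x‖) +
      ENNReal.ofReal (t⁻¹ ^ 2) * (ENNReal.ofReal (4 * B ^ 2) *
        ∫⁻ x in {x | ‖f x‖ ≤ c}, ENNReal.ofReal (‖f x‖ ^ 2)) := by
  set s := {x | c < ‖f x‖} with hs
  have hsc : sᶜ = {x | ‖f x‖ ≤ c} := by ext; simp [hs]
  have hsm : MeasurableSet s := measurableSet_lt measurable_const f.continuous.norm.measurable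
  have h2a : MemLp (s.indicator f) 2 volume := (f.memLp 2).indicator hsm
  have h2b : MemLp (sᶜ.indicator f) 2 volume := (f.memLp 2).indicator hsm.compl
  have hadd : (f : E → ℂ) = s.indicator f + sᶜ.indicator f := (indicator_self_add_compl s f).symm
  have hia : AEStronglyMeasurable (K ⋆[.mul ℂ ℂ] (s.indicator f)) volume :=
    (K.integrable.integrable_convolution _ (f.integrable.indicator hsm)).1
  have hib : AEStronglyMeasurable (K ⋆[.mul ℂ ℂ] (sᶜ.indicator f)) volume :=
    (K.integrable.integrable_convolution _ (f.integrable.indicator hsm.compl)).1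
  have hsub : {x | t < ‖(K ⋆[.mul ℂ ℂ] f) x‖} ⊆
      {x | ENNReal.ofReal (t / 2) ≤ ‖(K ⋆[.mul ℂ ℂ] (s.indicator f)) x‖ₑ} ∪
      {x | ENNReal.ofReal (t / 2) ≤ ‖(K ⋆[.mul ℂ ℂ] (sᶜ.indicator f)) x‖ₑ} := by
    intro x (hx : t < _)
    rw [hadd, (K.convolution_of_memLp_two_norm_le h2a x).1.distrib_add
      (K.convolution_of_memLp_two_norm_le h2b x).1] at hx
    simp only [mem_union, mem_ofPred_eq, ← ofReal_norm]
    by_contra! hcon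
    have h1 := (ENNReal.ofReal_lt_ofReal_iff (by positivity)).1 hcon.1
    have h2 := (ENNReal.ofReal_lt_ofReal_iff (by positivity)).1 hcon.2
    linarith [norm_add_le ((K ⋆[.mul ℂ ℂ] (s.indicator f)) x) ((K ⋆[.mul ℂ ℂ] (sᶜ.indicator f)) x)]
  have ht2 : ENNReal.ofReal (t / 2) ≠ 0 := by simpa using ht
  have hinv : (ENNReal.ofReal (t / 2))⁻¹ = ENNReal.ofReal (t⁻¹ * 2) := by
    rw [← ENNReal.ofReal_inv_of_pos (by positivity), inv_div]; ring_nf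
  refine (measure_mono hsub).trans ((measure_union_le _ _).trans (add_le_add ?_ ?_))
  · refine (meas_ge_le_mul_pow_eLpNorm_enorm (p := 1) volume one_ne_zero ENNReal.one_ne_top hia ht2
      (by simp)).trans ?_
    simp only [ENNReal.toReal_one, ENNReal.rpow_one]
    have := (eLpNorm_one_convolution_le K.continuous.aestronglyMeasurable
      (f.integrable.indicator hsm).1).trans (mul_le_mul_left hA _)
    refine (mul_le_mul_right this _).trans (le_of_eq ?_)
    rw [eLpNorm_indicator_eq_eLpNorm_restrict hsm, eLpNorm_one_eq_lintegral_enorm, hinv,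
      ENNReal.ofReal_mul (by positivity), ENNReal.ofReal_mul (by positivity)]
    simp only [ofReal_norm]
    ring
  · refine (meas_ge_le_mul_pow_eLpNorm_enorm (p := 2) volume two_ne_zero ENNReal.ofNat_ne_top hib ht2
      (by simp)).trans ?_
    simp only [ENNReal.toReal_ofNat]
    have := K.eLpNorm_two_convolution_le_of_memLp h2b hB
    refine (mul_le_mul_right (ENNReal.rpow_le_rpow this (by norm_num)) _).trans (le_of_eq ?_)
    rw [eLpNorm_indicator_eq_eLpNorm_restrict hsm.compl, ENNReal.mul_rpow_of_nonneg _ _ (by norm_num),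
      eLpNorm_eq_lintegral_rpow_enorm_toReal two_ne_zero ENNReal.ofNat_ne_top, ← ENNReal.rpow_mul,
      hinv, ← hsc, ENNReal.ofReal_rpow_of_nonneg (by positivity) (by norm_num),
      ENNReal.ofReal_rpow_of_nonneg hB0 (by norm_num), ← mul_assoc, ← mul_assoc,
      ← ENNReal.ofReal_mul (by positivity), ← ENNReal.ofReal_mul (by positivity)]
    norm_num
    congr 2
    ring

/-- Interpolation for convolution operators: the `L¹` norm of the kernel and the sup norm of the
multiplier control the `Lᵖ` operator norm for `1 ≤ p ≤ 2`, with the Riesz-Thorin exponents. -/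
theorem exists_eLpNorm_convolution_le {p : ℝ} (hp1 : 1 ≤ p) (hp2 : p ≤ 2) :
    ∃ C : ℝ, 0 < C ∧ ∀ (K : 𝓢(E, ℂ)) (A B : ℝ), 0 < A → 0 < B →
      eLpNorm K 1 volume ≤ ENNReal.ofReal A → (∀ ξ, ‖𝓕 K ξ‖ ≤ B) → ∀ f : 𝓢(E, ℂ),
      eLpNorm (K ⋆[.mul ℂ ℂ] f) (ENNReal.ofReal p) volume ≤
        ENNReal.ofReal (C * (A ^ ((2 - p) / p) * B ^ (2 * (1 - 1 / p)))) *
          eLpNorm f (ENNReal.ofReal p) volume := by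
  rcases hp1.eq_or_lt with rfl | hp1
  · refine ⟨1, one_pos, fun K A B _ _ hA _ f => ?_⟩
    have := (eLpNorm_one_convolution_le K.continuous.aestronglyMeasurable
      f.continuous.aestronglyMeasurable).trans (mul_le_mul_left hA _)
    norm_num
    exact this
  rcases hp2.eq_or_lt with rfl | hp2
  · refine ⟨1, one_pos, fun K A B _ _ _ hB f => ?_⟩
    have := K.eLpNorm_two_convolution_le f hB
    norm_num
    exact this
  have hp0 : 0 < p := by linarith
  have hq1 : 0 < p - 1 := by linarith
  have hq2 : 0 < 2 - p := by linarith
  refine ⟨(p * (2 / (p - 1) + 4 / (2 - p))) ^ (1 / p), by positivity,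
    fun K A B hA0 hB0 hA hB f => ?_⟩
  have hcont : Continuous (K ⋆[.mul ℂ ℂ] f) := by
    rw [show (K ⋆[.mul ℂ ℂ] f) = SchwartzMap.convolution (.mul ℂ ℂ) K f from
      funext fun x => (SchwartzMap.convolution_apply _ K f x).symm]
    exact (SchwartzMap.convolution (.mul ℂ ℂ) K f).continuous
  have hs : 0 < A / B ^ 2 := by positivity
  have key := lintegral_rpow_le_of_meas_lt_le (μ := (volume : Measure E)) (u := fun x => ‖f x‖)
    (v := fun x => ‖(K ⋆[.mul ℂ ℂ] f) x‖) f.continuous.norm.measurable (fun x => norm_nonneg _)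
    hcont.norm.measurable (fun x => norm_nonneg _) hp1 hp2 hs
    (fun t ht => K.volume_lt_norm_convolution_le f hB0.le hA hB (A / B ^ 2 * t) ht)
  have hconst : ENNReal.ofReal p * (ENNReal.ofReal (2 * A) *
      ENNReal.ofReal ((A / B ^ 2) ^ (1 - p) / (p - 1)) +
      ENNReal.ofReal (4 * B ^ 2) * ENNReal.ofReal ((A / B ^ 2) ^ (2 - p) / (2 - p))) =
      ENNReal.ofReal (p * (2 / (p - 1) + 4 / (2 - p)) * (A ^ (2 - p) * B ^ (2 * (p - 1)))) := by
    rw [← ENNReal.ofReal_mul (by positivity), ← ENNReal.ofReal_mul (by positivity),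
      ← ENNReal.ofReal_add (by positivity) (by positivity), ← ENNReal.ofReal_mul (by positivity)]
    congr 1
    have hBq : ∀ q : ℝ, (B ^ 2) ^ q = B ^ (2 * q) := fun q => by
      rw [← Real.rpow_natCast, ← Real.rpow_mul hB0.le]; norm_num
    have e1 : A * (A / B ^ 2) ^ (1 - p) = A ^ (2 - p) * B ^ (2 * (p - 1)) := by
      rw [Real.div_rpow hA0.le (by positivity), hBq, div_eq_mul_inv, ← Real.rpow_neg hB0.le,
        show 2 - p = 1 + (1 - p) by ring, Real.rpow_add hA0, Real.rpow_one]
      ring_nf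
    have e2 : B ^ 2 * (A / B ^ 2) ^ (2 - p) = A ^ (2 - p) * B ^ (2 * (p - 1)) := by
      rw [Real.div_rpow hA0.le (by positivity), hBq, div_eq_mul_inv, ← Real.rpow_neg hB0.le,
        show 2 * (p - 1) = 2 + -(2 * (2 - p)) by ring, Real.rpow_add hB0]
      norm_num
      ring
    linear_combination p * 2 / (p - 1) * e1 + p * 4 / (2 - p) * e2
  have hnorm : ∀ g : E → ℂ, eLpNorm g (ENNReal.ofReal p) volume =
      (∫⁻ x, ENNReal.ofReal (‖g x‖ ^ p)) ^ (1 / p) := fun g => by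
    rw [eLpNorm_eq_lintegral_rpow_enorm_toReal (by simpa using hp0) ENNReal.ofReal_ne_top,
      ENNReal.toReal_ofReal hp0.le]
    simp only [← ofReal_norm, ENNReal.ofReal_rpow_of_nonneg (norm_nonneg _) hp0.le]
  rw [hconst] at key
  rw [hnorm, hnorm]
  refine (ENNReal.rpow_le_rpow key (by positivity)).trans (le_of_eq ?_)
  rw [ENNReal.mul_rpow_of_nonneg _ _ (by positivity),
    ENNReal.ofReal_rpow_of_nonneg (by positivity) (by positivity)]
  congr 2
  rw [Real.mul_rpow (by positivity) (by positivity),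
    Real.mul_rpow (x := A ^ _) (by positivity) (by positivity),
    ← Real.rpow_mul hA0.le, ← Real.rpow_mul hB0.le]
  congr 3 <;> field_simp

end Convolution

section Sphere

open scoped Pointwise

/-- The rotation-invariant probability measure on the unit sphere, as a measure on the ambient
space. -/
def sphereMeasure (d : ℕ) : Measure (Ed d) :=
  (sphereProb d).map Subtype.val

theorem isProbabilityMeasure_sphereMeasure {d : ℕ} (hd : 2 ≤ d) :
    IsProbabilityMeasure (sphereMeasure d) := by
  have : Nonempty (Fin d) := ⟨⟨0, by omega⟩⟩
  have : NeZero (volume : Measure (Ed d)).toSphere := ⟨Measure.toSphere_ne_zero _⟩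
  have : IsProbabilityMeasure (sphereProb d) := by
    unfold sphereProb
    infer_instance
  exact Measure.isProbabilityMeasure_map measurable_subtype_coe.aemeasurable

theorem ae_norm_eq_one_sphereMeasure (d : ℕ) : ∀ᵐ y ∂(sphereMeasure d), ‖y‖ = 1 := by
  rw [sphereMeasure, ae_map_iff measurable_subtype_coe.aemeasurable
    (measurableSet_eq_fun (by fun_prop) (by fun_prop))]
  exact Eventually.of_forall fun y => by simp

theorem map_sphereMeasure {d : ℕ} (R : Ed d ≃ₗᵢ[ℝ] Ed d) :
    (sphereMeasure d).map R = sphereMeasure d := by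
  ext s hs
  have himg : ∀ t : Set (Ed d), ((↑) '' ((↑) ⁻¹' t : Set (sphere (0 : Ed d) 1)) : Set (Ed d)) =
      t ∩ sphere 0 1 := fun t => by rw [Subtype.image_preimage_coe, inter_comm]
  have hR : (R ⁻¹' s ∩ sphere 0 1 : Set (Ed d)) = R ⁻¹' (s ∩ sphere 0 1) := by
    ext x; simp
  have hsm : Ioo (0 : ℝ) 1 • (R ⁻¹' (s ∩ sphere 0 1)) = R ⁻¹' (Ioo (0 : ℝ) 1 • (s ∩ sphere 0 1)) := by
    ext x
    simp only [Set.mem_smul, mem_preimage]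
    constructor
    · rintro ⟨a, ha, y, hy, rfl⟩
      exact ⟨a, ha, R y, hy, by simp⟩
    · rintro ⟨a, ha, y, hy, hxy⟩
      refine ⟨a, ha, R.symm y, by simpa using hy, ?_⟩
      apply R.injective
      simp [← hxy]
  have hRm : Measurable R := R.continuous.measurable
  rw [Measure.map_apply hRm hs, sphereMeasure, Measure.map_apply measurable_subtype_coe (hRm hs),
    Measure.map_apply measurable_subtype_coe hs, sphereProb, Measure.smul_apply, Measure.smul_apply,
    Measure.toSphere_apply' _ (measurable_subtype_coe (hRm hs)),
    Measure.toSphere_apply' _ (measurable_subtype_coe hs), himg, himg, hR, hsm,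
    R.measurePreserving.measure_preimage_emb R.toHomeomorph.measurableEmbedding]

theorem sigmaHat_eq {d : ℕ} (ξ : Ed d) :
    sigmaHat d ξ = ∫ y, eChar (-(2 * Real.pi * ⟪ξ, y⟫)) ∂(sphereMeasure d) := by
  rw [sphereMeasure, (MeasurableEmbedding.subtype_coe isClosed_sphere.measurableSet).integral_map]
  rfl

end Sphere

section ODE

theorem hasDerivAt_pow_div {r : ℝ} (hr : r ≠ 0) (n : ℕ) :
    HasDerivAt (fun r : ℝ => r ^ n) (n / r * r ^ n) r := by
  refine (hasDerivAt_pow n r).congr_deriv ?_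
  cases n with
  | zero => simp
  | succ n =>
    rw [Nat.add_sub_cancel, pow_succ]
    field_simp

/-- Energy estimate for the Bessel-type equation `g'' + (n / r) g' + g = 0`. -/
theorem pow_mul_sq_add_sq_le_of_hasDerivAt {n : ℕ} {B : ℝ} {g g₁ : ℝ → ℝ}
    (hg : ∀ r, 0 < r → HasDerivAt g (g₁ r) r)
    (hg₁ : ∀ r, 0 < r → HasDerivAt g₁ (-(n / r * g₁ r) - g r) r)
    (hB : ∀ r, |g r| ≤ B) (hB₁ : ∀ r, |g₁ r| ≤ B) {r : ℝ} (hr : 0 < r) :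
    r ^ n * (g r ^ 2 + g₁ r ^ 2) ≤ 6 * Real.exp 1 * B ^ 2 * (n + 1) ^ n := by
  have hsq : ∀ r, g r ^ 2 + g₁ r ^ 2 ≤ 2 * B ^ 2 := fun r => by
    have h1 := sq_le_sq' (by linarith [neg_abs_le (g r), hB r]) ((le_abs_self _).trans (hB r))
    have h2 := sq_le_sq' (by linarith [neg_abs_le (g₁ r), hB₁ r]) ((le_abs_self _).trans (hB₁ r))
    linarith
  have he : 1 ≤ Real.exp 1 := Real.one_le_exp zero_le_one
  have hn : (0 : ℝ) ≤ n := n.cast_nonneg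
  rcases le_total r (n + 1) with h | h
  · calc r ^ n * (g r ^ 2 + g₁ r ^ 2) ≤ (n + 1) ^ n * (2 * B ^ 2) := by
          gcongr
          exact hsq r
      _ = 2 * 1 * B ^ 2 * (n + 1) ^ n := by ring
      _ ≤ _ := by gcongr; norm_num
  · have hquad : ∀ r : ℝ, (n : ℝ) + 1 ≤ r → |n / r * (g r * g₁ r)| ≤ (g r ^ 2 + g₁ r ^ 2) / 2 := by
      intro r h
      have hr0 : 0 < r := by linarith
      rw [abs_mul, abs_mul, abs_of_nonneg (by positivity)]
      have h1 : n / r ≤ 1 := (div_le_one hr0).2 (by linarith)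
      have h2 : |g r| * |g₁ r| ≤ (g r ^ 2 + g₁ r ^ 2) / 2 := by
        nlinarith [sq_abs (g r), sq_abs (g₁ r), sq_nonneg (|g r| - |g₁ r|)]
      calc n / r * (|g r| * |g₁ r|) ≤ 1 * (|g r| * |g₁ r|) := by gcongr
        _ ≤ _ := by linarith
    set Φ : ℝ → ℝ := fun r => r ^ n * (g r ^ 2 + g₁ r ^ 2 + n / r * (g r * g₁ r)) * Real.exp (n / r)
    have hderiv : ∀ r, 0 < r → HasDerivAt Φ (-(n / r ^ 2) * (r ^ n * Real.exp (n / r)) *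
        (g r * g₁ r + (g r ^ 2 + g₁ r ^ 2 + n / r * (g r * g₁ r)))) r := by
      intro r hr
      have hinv : HasDerivAt (fun r : ℝ => (n : ℝ) / r) (-(n / r ^ 2)) r := by
        simpa only [div_eq_mul_inv, mul_neg] using (hasDerivAt_inv hr.ne').const_mul (n : ℝ)
      have h := ((hasDerivAt_pow_div hr.ne' n).mul ((((hg r hr).pow 2).add ((hg₁ r hr).pow 2)).add
        (hinv.mul ((hg r hr).mul (hg₁ r hr))))).mul hinv.exp
      refine h.congr_deriv ?_
      simp only [Pi.add_apply, Pi.mul_apply, Pi.pow_apply]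
      field_simp
      ring
    have hanti : AntitoneOn Φ (Ici ((n : ℝ) + 1)) := by
      refine antitoneOn_of_deriv_nonpos (convex_Ici _) (fun x hx => ?_) (fun x hx => ?_)
        (fun x hx => ?_)
      · have : (n : ℝ) + 1 ≤ x := hx
        exact (hderiv x (by linarith)).continuousAt.continuousWithinAt
      · have : (n : ℝ) + 1 < x := by simpa using hx
        exact (hderiv x (by linarith)).differentiableAt.differentiableWithinAt
      · have hx' : (n : ℝ) + 1 < x := by simpa using hx
        have hx0 : 0 < x := by linarith
        rw [(hderiv x hx0).deriv]
        have h1 := (abs_le.1 (hquad x hx'.le)).1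
        have h2 : 0 ≤ g x * g₁ x + (g x ^ 2 + g₁ x ^ 2 + n / x * (g x * g₁ x)) := by
          nlinarith [sq_nonneg (g x + g₁ x)]
        have h3 : 0 ≤ (n / x ^ 2) * (x ^ n * Real.exp (n / x)) := by positivity
        nlinarith [mul_nonneg h3 h2]
    have hΦ := hanti (mem_Ici.2 le_rfl) (mem_Ici.2 h) h
    have hup : Φ (n + 1) ≤ (n + 1) ^ n * (3 * B ^ 2) * Real.exp 1 := by
      have h1 := (abs_le.1 (hquad (n + 1) le_rfl)).2
      have h2 := hsq (n + 1)
      have h3 := (abs_le.1 (hquad (n + 1) le_rfl)).1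
      have h4 : (n : ℝ) / (n + 1) ≤ 1 := (div_le_one (by positivity)).2 (by linarith)
      simp only [Φ]
      gcongr
      linarith
    have hlow : r ^ n * ((g r ^ 2 + g₁ r ^ 2) / 2) ≤ Φ r := by
      have h1 := (abs_le.1 (hquad r h)).1
      have h2 : (1 : ℝ) ≤ Real.exp (n / r) := Real.one_le_exp (by positivity)
      have h3 : (g r ^ 2 + g₁ r ^ 2) / 2 ≤ g r ^ 2 + g₁ r ^ 2 + n / r * (g r * g₁ r) := by linarith
      calc r ^ n * ((g r ^ 2 + g₁ r ^ 2) / 2) ≤ r ^ n * (g r ^ 2 + g₁ r ^ 2 + n / r * (g r * g₁ r)) := by gcongr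
        _ = r ^ n * (g r ^ 2 + g₁ r ^ 2 + n / r * (g r * g₁ r)) * 1 := (mul_one _).symm
        _ ≤ Φ r := by
          have : 0 ≤ g r ^ 2 + g₁ r ^ 2 + n / r * (g r * g₁ r) := le_trans (by positivity) h3
          simp only [Φ]
          gcongr
    linarith

end ODE

section Decay

open Complex

theorem norm_eChar (r : ℝ) : ‖eChar r‖ = 1 := norm_exp_ofReal_mul_I r

@[fun_prop]
theorem continuous_eChar : Continuous eChar := by
  unfold eChar
  fun_prop

theorem hasDerivAt_eChar (r : ℝ) : HasDerivAt eChar (eChar r * I) r := by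
  have h := ((ofRealCLM.hasDerivAt (x := r)).mul_const I).cexp
  simp only [ofRealCLM_apply, ofReal_one, one_mul] at h
  exact h

variable {d : ℕ}

theorem integrable_sphereMeasure_of_continuous (hd : 2 ≤ d) {w : Ed d → ℂ} (hw : Continuous w) :
    Integrable w (sphereMeasure d) := by
  have := isProbabilityMeasure_sphereMeasure hd
  obtain ⟨C, hC⟩ := (isCompact_sphere (0 : Ed d) 1).exists_bound_of_continuousOn hw.continuousOn
  refine Integrable.of_bound hw.aestronglyMeasurable C ?_
  filter_upwards [ae_norm_eq_one_sphereMeasure d] with y hy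
  exact hC y (by simpa using hy)

/-- The Fourier transform (without the factor `2π`) of the measure `w dσ`. -/
def sphereFourier (w : Ed d → ℂ) (ξ : Ed d) : ℂ :=
  ∫ y, eChar (-⟪ξ, y⟫) * w y ∂(sphereMeasure d)

theorem norm_sphereFourier_le (hd : 2 ≤ d) {w : Ed d → ℂ} {M : ℝ}
    (hw : ∀ y, ‖y‖ = 1 → ‖w y‖ ≤ M) (ξ : Ed d) : ‖sphereFourier w ξ‖ ≤ M := by
  have := isProbabilityMeasure_sphereMeasure hd
  refine (norm_integral_le_of_norm_le_const (C := M) ?_).trans (by simp)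
  filter_upwards [ae_norm_eq_one_sphereMeasure d] with y hy
  rw [norm_mul, norm_eChar, one_mul]
  exact hw y hy

theorem hasDerivAt_sphereFourier (hd : 2 ≤ d) {w : Ed d → ℂ} (hw : Continuous w) (ξ v : Ed d)
    (s : ℝ) : HasDerivAt (fun s : ℝ => sphereFourier w (ξ + s • v))
      (sphereFourier (fun y => -I * ⟪v, y⟫ * w y) (ξ + s • v)) s := by
  refine (hasDerivAt_integral_of_dominated_loc_of_deriv_le
    (F := fun (s : ℝ) (y : Ed d) => eChar (-⟪ξ + s • v, y⟫) * w y)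
    (F' := fun (s : ℝ) (y : Ed d) => eChar (-⟪ξ + s • v, y⟫) * (-I * ⟪v, y⟫ * w y))
    (bound := fun y => ‖-I * ⟪v, y⟫ * w y‖) (s := univ) univ_mem ?_ ?_ ?_ ?_ ?_ ?_).2
  · exact Eventually.of_forall fun s => by
      apply Continuous.aestronglyMeasurable
      fun_prop
  · exact integrable_sphereMeasure_of_continuous hd (by fun_prop)
  · apply Continuous.aestronglyMeasurable
    fun_prop
  · exact Eventually.of_forall fun y s _ => by rw [norm_mul, norm_eChar, one_mul]
  · exact (integrable_sphereMeasure_of_continuous hd (by fun_prop)).norm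
  · refine Eventually.of_forall fun y s _ => ?_
    have h1 : HasDerivAt (fun s : ℝ => -⟪ξ + s • v, y⟫) (-⟪v, y⟫) s := by
      simp only [inner_add_left, real_inner_smul_left]
      have h := (((hasDerivAt_id s).mul_const ⟪v, y⟫).const_add ⟪ξ, y⟫).neg
      rw [one_mul] at h
      exact h
    refine (((hasDerivAt_eChar _).scomp s h1).mul_const (w y)).congr_deriv ?_
    simp only [real_smul, ofReal_neg]
    ring

theorem sphereFourier_inner_eq_zero {u ξ : Ed d} (h : ⟪u, ξ⟫ = 0) :
    sphereFourier (fun y => (⟪u, y⟫ : ℂ)) ξ = 0 := by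
  set R := (Submodule.span ℝ {u})ᗮ.reflection
  have hRξ : R ξ = ξ := Submodule.reflection_mem_subspace_eq_self
    (Submodule.mem_orthogonal_singleton_iff_inner_right.2 h)
  have hRu : R u = -u := Submodule.reflection_orthogonalComplement_singleton_eq_neg u
  have hinv : ∀ a y : Ed d, ⟪a, R y⟫ = ⟪R a, y⟫ := fun a y => by
    rw [← R.inner_map_map a (R y), Submodule.reflection_reflection]
  have key : sphereFourier (fun y => (⟪u, y⟫ : ℂ)) ξ = -sphereFourier (fun y => (⟪u, y⟫ : ℂ)) ξ := by
    conv_lhs => rw [sphereFourier, ← map_sphereMeasure R]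
    rw [integral_map R.continuous.measurable.aemeasurable
      (Continuous.aestronglyMeasurable (by fun_prop)), sphereFourier, ← integral_neg]
    refine integral_congr_ae (Eventually.of_forall fun y => ?_)
    simp only [hinv, hRξ, hRu, inner_neg_left, ofReal_neg, mul_neg]
  exact self_eq_neg.1 key

theorem sphereFourier_const_mul (c : ℂ) (w : Ed d → ℂ) (ξ : Ed d) :
    sphereFourier (fun y => c * w y) ξ = c * sphereFourier w ξ := by
  rw [sphereFourier, sphereFourier, ← integral_const_mul]
  congr 1 with y
  ring

theorem sphereFourier_add (hd : 2 ≤ d) {w w' : Ed d → ℂ} (hw : Continuous w) (hw' : Continuous w')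
    (ξ : Ed d) :
    sphereFourier (fun y => w y + w' y) ξ = sphereFourier w ξ + sphereFourier w' ξ := by
  simp only [sphereFourier, mul_add]
  exact integral_add (integrable_sphereMeasure_of_continuous hd (by fun_prop))
    (integrable_sphereMeasure_of_continuous hd (by fun_prop))

theorem sphereFourier_inner_smul_add (hd : 2 ≤ d) (a b : ℝ) (u v ξ : Ed d) :
    sphereFourier (fun y => (⟪a • u + b • v, y⟫ : ℂ)) ξ =
      a * sphereFourier (fun y => (⟪u, y⟫ : ℂ)) ξ + b * sphereFourier (fun y => (⟪v, y⟫ : ℂ)) ξ := by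
  rw [← sphereFourier_const_mul, ← sphereFourier_const_mul,
    ← sphereFourier_add hd (by fun_prop) (by fun_prop)]
  simp only [inner_add_left, real_inner_smul_left, ofReal_add, ofReal_mul]

/-- Infinitesimal rotation invariance of the sphere measure. -/
theorem mul_sphereFourier_inner_sq (hd : 2 ≤ d) {e v : Ed d} (he : ‖e‖ = 1) (hv : ⟪v, e⟫ = 0)
    (r : ℝ) :
    r * sphereFourier (fun y => (⟪v, y⟫ : ℂ) ^ 2) (r • e) =
      I * ‖v‖ ^ 2 * sphereFourier (fun y => (⟪e, y⟫ : ℂ)) (r • e) := by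
  have h0 : (fun s : ℝ => ((s * -‖v‖ ^ 2 : ℝ) : ℂ) *
      sphereFourier (fun y => (⟪e, y⟫ : ℂ)) (r • e + s • v) +
      r * sphereFourier (fun y => (⟪v, y⟫ : ℂ)) (r • e + s • v)) = fun _ => 0 := by
    ext s
    rw [← sphereFourier_inner_smul_add hd]
    apply sphereFourier_inner_eq_zero
    simp only [inner_add_left, inner_add_right, real_inner_smul_left, real_inner_smul_right,
      real_inner_self_eq_norm_sq, hv, real_inner_comm v e, he]
    ring
  have h1 := ((((hasDerivAt_id (0 : ℝ)).mul_const (-‖v‖ ^ 2)).ofReal_comp).mul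
    (hasDerivAt_sphereFourier hd (w := fun y => (⟪e, y⟫ : ℂ)) (by fun_prop) (r • e) v 0)).add
    ((hasDerivAt_sphereFourier hd (w := fun y => (⟪v, y⟫ : ℂ)) (by fun_prop) (r • e) v 0).const_mul
      (r : ℂ))
  have h2 := h1.unique (f := _) (by
    refine (hasDerivAt_const (0 : ℝ) (0 : ℂ)).congr_of_eventuallyEq (Eventually.of_forall fun s => ?_)
    exact congrFun h0 s)
  have h3 : (fun y : Ed d => -I * (⟪v, y⟫ : ℂ) * (⟪v, y⟫ : ℂ)) = fun y => -I * (⟪v, y⟫ : ℂ) ^ 2 := by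
    ext y; ring
  rw [h3, sphereFourier_const_mul] at h2
  simp only [zero_smul, add_zero, id, zero_mul, ofReal_zero, one_mul, ofReal_neg, ofReal_pow] at h2
  linear_combination I * h2 + (r * sphereFourier (fun y => (⟪v, y⟫ : ℂ) ^ 2) (r • e)) * I_sq

theorem mul_sphereFourier_one_sub (hd : 2 ≤ d) {e : Ed d} (he : ‖e‖ = 1) (r : ℝ) :
    r * (sphereFourier (fun _ => 1) (r • e) - sphereFourier (fun y => (⟪e, y⟫ : ℂ) ^ 2) (r • e)) =
      I * (d - 1) * sphereFourier (fun y => (⟪e, y⟫ : ℂ)) (r • e) := by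
  let b := EuclideanSpace.basisFun (Fin d) ℝ
  let v : Fin d → Ed d := fun i => b i - ⟪e, b i⟫ • e
  have hv : ∀ i, ⟪v i, e⟫ = 0 := fun i => by
    simp only [v, inner_sub_left, real_inner_smul_left, real_inner_self_eq_norm_sq, he,
      real_inner_comm e (b i)]
    ring
  have hinner : ∀ y, ∑ i, ⟪v i, y⟫ ^ 2 = ‖y‖ ^ 2 - ⟪e, y⟫ ^ 2 := fun y => by
    have h1 : ∀ i, ⟪v i, y⟫ ^ 2 =
        ⟪y, b i⟫ * ⟪b i, y⟫ - 2 * ⟪e, y⟫ * (⟪e, b i⟫ * ⟪b i, y⟫) +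
          ⟪e, y⟫ ^ 2 * (⟪e, b i⟫ * ⟪b i, e⟫) := fun i => by
      simp only [v, inner_sub_left, real_inner_smul_left, real_inner_comm y (b i),
        real_inner_comm e (b i)]
      ring
    simp only [h1, Finset.sum_add_distrib, Finset.sum_sub_distrib, ← Finset.mul_sum,
      b.sum_inner_mul_inner, real_inner_self_eq_norm_sq, he]
    ring
  have hnorm : ∑ i, ‖v i‖ ^ 2 = d - 1 := by
    have h1 : ∀ i, ‖v i‖ ^ 2 = 1 - ⟪e, b i⟫ * ⟪b i, e⟫ := fun i => by
      rw [← real_inner_self_eq_norm_sq]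
      nth_rw 2 [show v i = b i - ⟪e, b i⟫ • e from rfl]
      rw [inner_sub_right, real_inner_smul_right, hv]
      simp only [v, inner_sub_left, real_inner_smul_left, real_inner_self_eq_norm_sq,
        b.norm_eq_one, real_inner_comm e (b i)]
      ring
    simp only [h1, Finset.sum_sub_distrib, b.sum_inner_mul_inner, real_inner_self_eq_norm_sq, he]
    simp
  have h1 : ∑ i, sphereFourier (fun y => (⟪v i, y⟫ : ℂ) ^ 2) (r • e) =
      sphereFourier (fun _ => 1) (r • e) - sphereFourier (fun y => (⟪e, y⟫ : ℂ) ^ 2) (r • e) := by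
    simp only [sphereFourier]
    rw [← integral_finsetSum _ fun i _ => integrable_sphereMeasure_of_continuous hd (by fun_prop),
      ← integral_sub (integrable_sphereMeasure_of_continuous hd (by fun_prop))
        (integrable_sphereMeasure_of_continuous hd (by fun_prop))]
    refine integral_congr_ae ?_
    filter_upwards [ae_norm_eq_one_sphereMeasure d] with y hy
    have h2 := hinner y
    rw [hy, one_pow] at h2
    rw [← Finset.mul_sum, ← mul_sub]
    congr 1
    exact_mod_cast h2
  rw [← h1, Finset.mul_sum, Finset.sum_congr rfl fun i _ => mul_sphereFourier_inner_sq hd he (hv i) r,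
    ← Finset.sum_mul, ← Finset.mul_sum]
  congr 2
  exact_mod_cast hnorm

theorem sphereFourier_decay_of_norm_eq_one (hd : 2 ≤ d) {e : Ed d} (he : ‖e‖ = 1) {r : ℝ}
    (hr : 0 < r) :
    r ^ (d - 1) * (‖sphereFourier (fun _ => 1) (r • e)‖ ^ 2 +
      ‖sphereFourier (fun y => (⟪e, y⟫ : ℂ)) (r • e)‖ ^ 2) ≤
        12 * Real.exp 1 * (d : ℝ) ^ (d - 1) := by
  let g : ℝ → ℂ := fun r => sphereFourier (fun _ => 1) (r • e)
  let g₁ : ℝ → ℂ := fun r => -I * sphereFourier (fun y => (⟪e, y⟫ : ℂ)) (r • e)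
  have hdcast : ((d - 1 : ℕ) : ℝ) = d - 1 := by
    rw [Nat.cast_sub (by omega), Nat.cast_one]
  have hg : ∀ r, 0 < r → HasDerivAt g (g₁ r) r := fun r _ => by
    have h := hasDerivAt_sphereFourier hd (w := fun _ => 1) (by fun_prop) 0 e r
    simp only [zero_add, mul_one, sphereFourier_const_mul] at h
    exact h
  have hg₁ : ∀ r, 0 < r → HasDerivAt g₁ (-(((d - 1 : ℕ) / r : ℝ) * g₁ r) - g r) r := fun r hr => by
    have h := (hasDerivAt_sphereFourier hd (w := fun y => (⟪e, y⟫ : ℂ)) (by fun_prop) 0 e r).const_mul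
      (-I)
    have h3 : (fun y : Ed d => -I * (⟪e, y⟫ : ℂ) * (⟪e, y⟫ : ℂ)) = fun y => -I * (⟪e, y⟫ : ℂ) ^ 2 := by
      ext y; ring
    simp only [zero_add, h3, sphereFourier_const_mul] at h
    refine h.congr_deriv ?_
    have hr' : (r : ℂ) ≠ 0 := ofReal_ne_zero.2 hr.ne'
    have h4 := mul_sphereFourier_one_sub hd he r
    simp only [g, g₁, hdcast]
    push_cast
    field_simp
    linear_combination h4 + r * sphereFourier (fun y => (⟪e, y⟫ : ℂ) ^ 2) (r • e) * I_sq
  have hB : ∀ r, ‖g r‖ ≤ 1 := fun r => norm_sphereFourier_le hd (by simp) _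
  have hB₁ : ∀ r, ‖g₁ r‖ ≤ 1 := fun r => by
    simp only [g₁, norm_mul, norm_neg, norm_I, one_mul]
    refine norm_sphereFourier_le hd (fun y hy => ?_) _
    rw [norm_real]
    simpa [he, hy] using norm_inner_le_norm (𝕜 := ℝ) e y
  have hre := pow_mul_sq_add_sq_le_of_hasDerivAt (n := d - 1) (B := 1) (g := fun r => (g r).re)
    (g₁ := fun r => (g₁ r).re) (fun r hr => reCLM.hasFDerivAt.comp_hasDerivAt r (hg r hr))
    (fun r hr => (reCLM.hasFDerivAt.comp_hasDerivAt r (hg₁ r hr)).congr_deriv (by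
      simp only [reCLM_apply, sub_re, neg_re, re_ofReal_mul]))
    (fun r => (abs_re_le_norm _).trans (hB r)) (fun r => (abs_re_le_norm _).trans (hB₁ r)) hr
  have him := pow_mul_sq_add_sq_le_of_hasDerivAt (n := d - 1) (B := 1) (g := fun r => (g r).im)
    (g₁ := fun r => (g₁ r).im) (fun r hr => imCLM.hasFDerivAt.comp_hasDerivAt r (hg r hr))
    (fun r hr => (imCLM.hasFDerivAt.comp_hasDerivAt r (hg₁ r hr)).congr_deriv (by
      simp only [imCLM_apply, sub_im, neg_im, im_ofReal_mul]))
    (fun r => (abs_im_le_norm _).trans (hB r)) (fun r => (abs_im_le_norm _).trans (hB₁ r)) hr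
  have hn : ‖sphereFourier (fun y => (⟪e, y⟫ : ℂ)) (r • e)‖ = ‖g₁ r‖ := by
    simp [g₁]
  rw [hn, show sphereFourier (fun _ => 1) (r • e) = g r from rfl, ← normSq_eq_norm_sq,
    ← normSq_eq_norm_sq, normSq_apply, normSq_apply]
  rw [hdcast, sub_add_cancel] at hre him
  linarith

/-- Decay of the Fourier transform of the sphere measure. -/
theorem sphereFourier_one_decay (hd : 2 ≤ d) (ξ : Ed d) :
    ‖ξ‖ ^ (d - 1) * ‖sphereFourier (fun _ => 1) ξ‖ ^ 2 ≤ 12 * Real.exp 1 * (d : ℝ) ^ (d - 1) := by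
  rcases eq_or_ne ξ 0 with rfl | hξ
  · rw [norm_zero, zero_pow (by omega), zero_mul]
    positivity
  have hξ' : ‖ξ‖ ≠ 0 := norm_ne_zero_iff.2 hξ
  have h := sphereFourier_decay_of_norm_eq_one hd (norm_smul_inv_norm (𝕜 := ℝ) hξ) (norm_pos_iff.2 hξ)
  simp only [RCLike.ofReal_real_eq_id, id, smul_inv_smul₀ hξ'] at h
  refine le_trans ?_ h
  gcongr
  exact le_add_of_nonneg_right (sq_nonneg _)

/-- Decay of the Fourier transform of the sphere measure with a linear weight. -/
theorem sphereFourier_inner_decay (hd : 2 ≤ d) {u : Ed d} (hu : ‖u‖ = 1) (ξ : Ed d) :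
    ‖ξ‖ ^ (d - 1) * ‖sphereFourier (fun y => (⟪u, y⟫ : ℂ)) ξ‖ ^ 2 ≤
      12 * Real.exp 1 * (d : ℝ) ^ (d - 1) := by
  rcases eq_or_ne ξ 0 with rfl | hξ
  · rw [norm_zero, zero_pow (by omega), zero_mul]
    positivity
  have hξ' : ‖ξ‖ ≠ 0 := norm_ne_zero_iff.2 hξ
  obtain ⟨e, he, hξe⟩ : ∃ e : Ed d, ‖e‖ = 1 ∧ ξ = ‖ξ‖ • e :=
    ⟨‖ξ‖⁻¹ • ξ, by simp [norm_smul, hξ'], by rw [smul_inv_smul₀ hξ']⟩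
  have h := sphereFourier_decay_of_norm_eq_one hd he (norm_pos_iff.2 hξ)
  rw [← hξe] at h
  have h0 : sphereFourier (fun y => (⟪(1 : ℝ) • u + (-⟪u, e⟫) • e, y⟫ : ℂ)) ξ = 0 := by
    apply sphereFourier_inner_eq_zero
    rw [hξe]
    simp only [inner_add_left, real_inner_smul_left, real_inner_smul_right,
      real_inner_self_eq_norm_sq, he]
    ring
  rw [sphereFourier_inner_smul_add hd, ofReal_one, one_mul, ofReal_neg, neg_mul,
    ← sub_eq_add_neg, sub_eq_zero] at h0
  have hue : ‖(⟪u, e⟫ : ℂ)‖ ≤ 1 := by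
    rw [norm_real]
    simpa [hu, he] using norm_inner_le_norm (𝕜 := ℝ) u e
  refine le_trans ?_ h
  gcongr
  rw [h0, norm_mul]
  refine le_trans ?_ (le_add_of_nonneg_left (sq_nonneg _))
  gcongr
  exact mul_le_of_le_one_left (norm_nonneg _) hue

end Decay

section Kernel

open Complex FourierTransform SchwartzMap Convolution

variable {d : ℕ}

theorem eChar_add (a b : ℝ) : eChar (a + b) = eChar a * eChar b := by
  simp only [eChar, ofReal_add, add_mul, exp_add]

theorem fourierInt_eq (f : Ed d → ℂ) : fourierInt d f = 𝓕 f := by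
  ext ξ
  rw [Real.fourier_eq, fourierInt]
  refine integral_congr_ae (Eventually.of_forall fun x => ?_)
  simp only [Circle.smul_def, Real.fourierChar_apply, smul_eq_mul, eChar, mul_neg,
    real_inner_comm x ξ]

theorem fourierInv_eq_integral_eChar (f : Ed d → ℂ) (x : Ed d) :
    𝓕⁻ f x = ∫ ξ, eChar (2 * Real.pi * ⟪ξ, x⟫) * f ξ := by
  rw [Real.fourierInv_eq]
  rfl

/-- The Fourier multiplier operator with symbol `m`. -/
def multiplierOp (m f : Ed d → ℂ) (x : Ed d) : ℂ :=
  ∫ ξ : Ed d, eChar (2 * Real.pi * ⟪ξ, x⟫) * (m ξ * fourierInt d f ξ)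

theorem multiplierOp_eq_convolution (m f : 𝓢(Ed d, ℂ)) :
    multiplierOp m f = SchwartzMap.convolution (.mul ℂ ℂ) (𝓕⁻ m) f := by
  ext x
  have h : SchwartzMap.convolution (.mul ℂ ℂ) (𝓕⁻ m) f =
      𝓕⁻ (SchwartzMap.pairing (.mul ℂ ℂ) m (𝓕 f)) := by
    rw [← fourierInv_fourier_eq (F := 𝓢(Ed d, ℂ)) (SchwartzMap.convolution (.mul ℂ ℂ) (𝓕⁻ m) f),
      SchwartzMap.fourier_convolution, fourier_fourierInv_eq]
  rw [h, fourierInv_coe, fourierInv_eq_integral_eChar, multiplierOp, fourierInt_eq]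
  rfl

theorem integrable_multiplierOp_integrand (m f : 𝓢(Ed d, ℂ)) (x : Ed d) :
    Integrable fun ξ => eChar (2 * Real.pi * ⟪ξ, x⟫) * (m ξ * fourierInt d f ξ) := by
  have h : Integrable (SchwartzMap.pairing (.mul ℂ ℂ) m (𝓕 f)) := SchwartzMap.integrable _
  refine (h.bdd_mul (c := 1) (f := fun ξ => eChar (2 * Real.pi * ⟪ξ, x⟫))
    (Continuous.aestronglyMeasurable (by fun_prop))
    (Eventually.of_forall fun ξ => (norm_eChar _).le)).congr (Eventually.of_forall fun ξ => ?_)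
  simp only [fourierInt_eq]
  rfl

theorem contDiff_sphereFourier (hd : 2 ≤ d) {w : Ed d → ℂ} (hw : Continuous w) :
    ContDiff ℝ (⊤ : ℕ∞) fun ξ : Ed d => sphereFourier w ((2 * Real.pi) • ξ) := by
  have h := VectorFourier.contDiff_fourierIntegral (f := w) (μ := sphereMeasure d) (N := ⊤)
    (innerSL ℝ) fun n _ => by
      have := (integrable_sphereMeasure_of_continuous hd (w := fun y => ((‖y‖ ^ n * ‖w y‖ : ℝ) : ℂ))
        (by fun_prop)).norm
      simpa using this
  refine (congrArg (ContDiff ℝ (⊤ : ℕ∞)) (funext fun ξ => integral_congr_ae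
    (Eventually.of_forall fun y => ?_))).mpr h
  simp only [Circle.smul_def, Real.fourierChar_apply, smul_eq_mul, eChar, real_inner_smul_left,
    real_inner_comm y ξ, mul_neg]
  rfl

/-- The symbol obtained by localizing the Fourier transform of `w dσ`, dilated by `t`, with a bump
function dilated by `s`. -/
def localizedSymbol (w b : Ed d → ℂ) (t s : ℝ) (ξ : Ed d) : ℂ :=
  sphereFourier w ((2 * Real.pi * t) • ξ) * b (s • ξ)

theorem exists_schwartzMap_eq_localizedSymbol (hd : 2 ≤ d) {w b : Ed d → ℂ} (hw : Continuous w)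
    (hb : ContDiff ℝ (⊤ : ℕ∞) b) (hbc : HasCompactSupport b) (t : ℝ) {s : ℝ} (hs : s ≠ 0) :
    ∃ m : 𝓢(Ed d, ℂ), ⇑m = localizedSymbol w b t s := by
  have h1 : ContDiff ℝ (⊤ : ℕ∞) (localizedSymbol w b t s) := by
    unfold localizedSymbol
    refine ContDiff.mul ?_ (hb.comp (contDiff_const_smul s))
    have := (contDiff_sphereFourier hd hw).comp (contDiff_const_smul (F := Ed d) (𝕜 := ℝ) t)
    simpa only [Function.comp_def, smul_smul] using this
  have h2 : HasCompactSupport (localizedSymbol w b t s) :=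
    (hbc.comp_smul hs).mul_left
  exact ⟨h2.toSchwartzMap h1, rfl⟩

theorem fourierInv_localizedSymbol (hd : 2 ≤ d) {w b : Ed d → ℂ} (hw : Continuous w)
    (hb : Continuous b) (hbc : HasCompactSupport b) (t : ℝ) {s : ℝ} (hs : s ≠ 0) (x : Ed d) :
    𝓕⁻ (localizedSymbol w b t s) x =
      ∫ y, w y * 𝓕⁻ (fun ξ => b (s • ξ)) (x - t • y) ∂(sphereMeasure d) := by
  have := isProbabilityMeasure_sphereMeasure hd
  have hbi : Integrable fun ξ => b (s • ξ) :=
    (hb.integrable_of_hasCompactSupport hbc).comp_smul hs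
  have hint : Integrable (fun z : Ed d × Ed d => eChar (2 * Real.pi * ⟪z.1, x - t • z.2⟫) *
      (b (s • z.1) * w z.2)) (volume.prod (sphereMeasure d)) := by
    refine (hbi.mul_prod (integrable_sphereMeasure_of_continuous hd hw)).bdd_mul (c := 1)
      (Continuous.aestronglyMeasurable (by fun_prop))
      (Eventually.of_forall fun z => (norm_eChar _).le)
  calc 𝓕⁻ (localizedSymbol w b t s) x
      = ∫ ξ, ∫ y, eChar (2 * Real.pi * ⟪ξ, x - t • y⟫) * (b (s • ξ) * w y) ∂(sphereMeasure d) := by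
        rw [fourierInv_eq_integral_eChar]
        refine integral_congr_ae (Eventually.of_forall fun ξ => ?_)
        simp only [localizedSymbol, sphereFourier]
        rw [← integral_mul_const, ← integral_const_mul]
        refine integral_congr_ae (Eventually.of_forall fun y => ?_)
        have h : 2 * Real.pi * ⟪ξ, x - t • y⟫ =
            2 * Real.pi * ⟪ξ, x⟫ + -⟪(2 * Real.pi * t) • ξ, y⟫ := by
          rw [inner_sub_right, real_inner_smul_right, real_inner_smul_left]
          ring
        simp only [h, eChar_add]
        ring
    _ = ∫ y, ∫ ξ, eChar (2 * Real.pi * ⟪ξ, x - t • y⟫) * (b (s • ξ) * w y) ∂volume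
          ∂(sphereMeasure d) :=
        integral_integral_swap hint
    _ = _ := by
        refine integral_congr_ae (Eventually.of_forall fun y => ?_)
        simp only [fourierInv_eq_integral_eChar, ← integral_const_mul]
        refine integral_congr_ae (Eventually.of_forall fun ξ => ?_)
        ring

theorem lintegral_enorm_fourierInv_comp_smul (b : Ed d → ℂ) {s : ℝ} (hs : s ≠ 0) :
    ∫⁻ x, ‖𝓕⁻ (fun ξ => b (s • ξ)) x‖ₑ = ∫⁻ x, ‖𝓕⁻ b x‖ₑ := by
  have h : ∀ x, 𝓕⁻ (fun ξ => b (s • ξ)) x = |(s ^ d)⁻¹| • 𝓕⁻ b (s⁻¹ • x) := fun x => by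
    have := Measure.integral_comp_smul (volume : Measure (Ed d))
      (fun ξ => eChar (2 * Real.pi * ⟪ξ, s⁻¹ • x⟫) * b ξ) s
    rw [finrank_euclideanSpace_fin] at this
    rw [fourierInv_eq_integral_eChar, fourierInv_eq_integral_eChar, ← this]
    refine integral_congr_ae (Eventually.of_forall fun ξ => ?_)
    simp only [real_inner_smul_left, real_inner_smul_right, inv_mul_cancel_left₀ hs]
  have hmap := Measure.map_addHaar_smul (volume : Measure (Ed d)) (inv_ne_zero hs)
  rw [finrank_euclideanSpace_fin] at hmap
  have hmap' : ∫⁻ x, ‖𝓕⁻ b (s⁻¹ • x)‖ₑ = ENNReal.ofReal |((s⁻¹) ^ d)⁻¹| * ∫⁻ x, ‖𝓕⁻ b x‖ₑ := by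
    rw [← smul_eq_mul, ← lintegral_smul_measure, ← hmap]
    exact (lintegral_map_equiv (fun x => ‖𝓕⁻ b x‖ₑ)
      (Homeomorph.smulOfNeZero s⁻¹ (inv_ne_zero hs)).toMeasurableEquiv).symm
  simp only [h, enorm_smul]
  rw [lintegral_const_mul' _ _ (by simp), hmap', ← mul_assoc, Real.enorm_eq_ofReal_abs,
    ← ENNReal.ofReal_mul (abs_nonneg _), abs_abs, ← abs_mul, inv_pow, inv_inv,
    inv_mul_cancel₀ (pow_ne_zero d hs), abs_one, ENNReal.ofReal_one, one_mul]

theorem lintegral_enorm_fourierInv_localizedSymbol_le (hd : 2 ≤ d) {w b : Ed d → ℂ}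
    (hw : Continuous w) (hw1 : ∀ y, ‖y‖ = 1 → ‖w y‖ ≤ 1)
    (hb : Continuous b) (hbc : HasCompactSupport b) (t : ℝ) {s : ℝ} (hs : s ≠ 0) :
    ∫⁻ x, ‖𝓕⁻ (localizedSymbol w b t s) x‖ₑ ≤ ∫⁻ x, ‖𝓕⁻ b x‖ₑ := by
  have := isProbabilityMeasure_sphereMeasure hd
  have hbi : Integrable fun ξ => b (s • ξ) :=
    (hb.integrable_of_hasCompactSupport hbc).comp_smul hs
  set φ : Ed d → ℂ := 𝓕⁻ (fun ξ => b (s • ξ))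
  have hφ : Continuous φ :=
    VectorFourier.fourierIntegral_continuous Real.continuous_fourierChar
      (L := -innerₗ (Ed d)) (continuous_inner.neg) hbi
  calc ∫⁻ x, ‖𝓕⁻ (localizedSymbol w b t s) x‖ₑ
      ≤ ∫⁻ x, ∫⁻ y, ‖φ (x - t • y)‖ₑ ∂(sphereMeasure d) := by
        refine lintegral_mono fun x => ?_
        rw [fourierInv_localizedSymbol hd hw hb hbc t hs]
        refine (enorm_integral_le_lintegral_enorm _).trans (lintegral_mono_ae ?_)
        filter_upwards [ae_norm_eq_one_sphereMeasure d] with y hy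
        rw [enorm_mul]
        refine mul_le_of_le_one_left' ?_
        rw [← ofReal_norm, ENNReal.ofReal_le_one]
        exact hw1 y hy
    _ = ∫⁻ y, ∫⁻ x, ‖φ (x - t • y)‖ₑ ∂volume ∂(sphereMeasure d) :=
        lintegral_lintegral_swap (Measurable.aemeasurable
          (Continuous.measurable (by unfold Function.uncurry; fun_prop)))
    _ = ∫⁻ _, ∫⁻ x, ‖φ x‖ₑ ∂volume ∂(sphereMeasure d) := by
        refine lintegral_congr fun y => ?_
        exact lintegral_sub_right_eq_self (fun x => ‖φ x‖ₑ) (t • y)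
    _ = ∫⁻ x, ‖𝓕⁻ b x‖ₑ := by
        rw [lintegral_const, measure_univ, mul_one, lintegral_enorm_fourierInv_comp_smul b hs]

end Kernel

section LocalizedSymbol

open Complex FourierTransform SchwartzMap Convolution

variable {d : ℕ}

theorem norm_localizedSymbol_le {w b : Ed d → ℂ} {D M : ℝ}
    (hD : ∀ ξ, ‖ξ‖ ^ (d - 1) * ‖sphereFourier w ξ‖ ^ 2 ≤ D) (hM : ∀ ξ, ‖b ξ‖ ≤ M)
    (hb0 : ∀ ξ, ‖ξ‖ < 1 / 2 → b ξ = 0) {t s : ℝ} (ht : 0 < t) (hs : 0 < s) (ξ : Ed d) :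
    ‖localizedSymbol w b t s ξ‖ ≤ M * √D * (t / s) ^ (-((d - 1 : ℕ) : ℝ) / 2) := by
  have hM0 : 0 ≤ M := (norm_nonneg _).trans (hM 0)
  rcases lt_or_ge ‖s • ξ‖ (1 / 2) with h | h
  · rw [localizedSymbol, hb0 _ h, mul_zero, norm_zero]
    positivity
  rw [norm_smul, Real.norm_of_nonneg hs.le] at h
  have hts : 0 < t / s := div_pos ht hs
  have hξ : t / s ≤ ‖(2 * Real.pi * t) • ξ‖ := by
    rw [norm_smul, Real.norm_of_nonneg (by positivity), div_le_iff₀ hs]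
    nlinarith [Real.pi_gt_three, mul_pos ht (by linarith : 0 < s * ‖ξ‖), mul_le_mul_of_nonneg_left h ht.le]
  have hJ : ‖sphereFourier w ((2 * Real.pi * t) • ξ)‖ ≤ √D * (t / s) ^ (-((d - 1 : ℕ) : ℝ) / 2) := by
    have h1 : (t / s) ^ (d - 1) * ‖sphereFourier w ((2 * Real.pi * t) • ξ)‖ ^ 2 ≤ D :=
      le_trans (by gcongr) (hD ((2 * Real.pi * t) • ξ))
    have hD0 : 0 ≤ D := le_trans (by positivity) h1
    have h2 : ((t / s) ^ (-((d - 1 : ℕ) : ℝ) / 2)) ^ 2 = ((t / s) ^ (d - 1))⁻¹ := by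
      rw [← Real.rpow_natCast, ← Real.rpow_natCast, ← Real.rpow_mul hts.le, ← Real.rpow_neg hts.le]
      congr 1
      push_cast
      ring
    refine (pow_le_pow_iff_left₀ (norm_nonneg _) (by positivity) two_ne_zero).1 ?_
    rw [mul_pow, Real.sq_sqrt hD0, h2, ← div_eq_mul_inv, le_div_iff₀' (by positivity)]
    exact h1
  rw [localizedSymbol, norm_mul, mul_comm, mul_assoc M]
  exact mul_le_mul (hM _) hJ (norm_nonneg _) hM0

/-- Smooth compactly supported functions that vanish near the origin. -/
def IsAnnular (b : Ed d → ℂ) : Prop :=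
  ContDiff ℝ (⊤ : ℕ∞) b ∧ HasCompactSupport b ∧ ∀ ξ, ‖ξ‖ < 1 / 2 → b ξ = 0

/-- `L^p` bounds, `1 ≤ p ≤ 2`, for the multiplier operators with localized symbols. -/
theorem exists_eLpNorm_multiplierOp_localizedSymbol_le (hd : 2 ≤ d) {p : ℝ} (hp1 : 1 ≤ p)
    (hp2 : p ≤ 2) {w b : Ed d → ℂ} (hw : Continuous w) (hw1 : ∀ y, ‖y‖ = 1 → ‖w y‖ ≤ 1) {D : ℝ}
    (hD : ∀ ξ, ‖ξ‖ ^ (d - 1) * ‖sphereFourier w ξ‖ ^ 2 ≤ D)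
    (hb : IsAnnular b) :
    ∃ C : ℝ, 0 < C ∧ ∀ t s : ℝ, 0 < t → 0 < s → ∀ f : 𝓢(Ed d, ℂ),
      eLpNorm (multiplierOp (localizedSymbol w b t s) f) (ENNReal.ofReal p) volume ≤
        ENNReal.ofReal (C * (t / s) ^ (-((d : ℝ) - 1) * (1 - 1 / p))) *
          eLpNorm f (ENNReal.ofReal p) volume := by
  obtain ⟨hb, hbc, hb0⟩ := hb
  obtain ⟨C, hC, hconv⟩ := exists_eLpNorm_convolution_le (E := Ed d) hp1 hp2
  obtain ⟨M, hM⟩ := hbc.exists_bound_of_continuous hb.continuous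
  set A : ℝ := max (∫ x, ‖𝓕⁻ b x‖) 1
  set M' : ℝ := max M 1
  set D' : ℝ := max D 1
  have hA : 0 < A := lt_max_of_lt_right one_pos
  have hM' : 0 < M' := lt_max_of_lt_right one_pos
  have hD' : 0 < D' := lt_max_of_lt_right one_pos
  refine ⟨C * (A ^ ((2 - p) / p) * (M' * √D') ^ (2 * (1 - 1 / p))), by positivity,
    fun t s ht hs f => ?_⟩
  obtain ⟨m, hm⟩ := exists_schwartzMap_eq_localizedSymbol hd hw hb hbc t hs.ne'
  have hts : 0 < t / s := div_pos ht hs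
  have hL1 : eLpNorm (𝓕⁻ m : 𝓢(Ed d, ℂ)) 1 volume ≤ ENNReal.ofReal A := by
    have hbi : Integrable (𝓕⁻ b) := by
      have := (𝓕⁻ (hbc.toSchwartzMap hb)).integrable (μ := volume)
      rwa [fourierInv_coe] at this
    rw [eLpNorm_one_eq_lintegral_enorm, fourierInv_coe, hm]
    refine (lintegral_enorm_fourierInv_localizedSymbol_le hd hw hw1 hb.continuous hbc t hs.ne').trans ?_
    rw [← ofReal_integral_norm_eq_lintegral_enorm hbi]
    exact ENNReal.ofReal_le_ofReal (le_max_left _ _)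
  have h := hconv (𝓕⁻ m) A (M' * √D' * (t / s) ^ (-((d - 1 : ℕ) : ℝ) / 2)) hA (by positivity) hL1
    (fun ξ => by
      rw [fourier_fourierInv_eq, hm]
      exact norm_localizedSymbol_le (fun ξ => (hD ξ).trans (le_max_left _ _))
        (fun ξ => (hM ξ).trans (le_max_left _ _)) hb0 ht hs ξ) f
  have hop : multiplierOp (localizedSymbol w b t s) f = (𝓕⁻ m : 𝓢(Ed d, ℂ)) ⋆[.mul ℂ ℂ] f := by
    rw [← hm, multiplierOp_eq_convolution]
    exact funext fun x => SchwartzMap.convolution_apply _ _ f x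
  rw [hop]
  convert h using 3
  rw [Real.mul_rpow (x := M' * √D') (by positivity) (by positivity),
    ← Real.rpow_mul hts.le, Nat.cast_sub (by omega),
    Nat.cast_one, ← mul_assoc (-((d : ℝ) - 1) / 2), div_mul_cancel₀ _ (two_ne_zero' ℝ)]
  ring

end LocalizedSymbol

section Assembly

open Complex SchwartzMap

variable {d : ℕ}

/-- The bump function `β₀(η) - β₀(2η)`. -/
def annularBump (β0 : Ed d → ℝ) (η : Ed d) : ℝ :=
  β0 η - β0 ((2 : ℝ) • η)

theorem contDiff_annularBump {β0 : Ed d → ℝ} (hβ0 : IsAdmissibleBump d β0) :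
    ContDiff ℝ (⊤ : ℕ∞) (annularBump β0) :=
  hβ0.1.sub (hβ0.1.comp (contDiff_const_smul 2))

theorem hasCompactSupport_annularBump {β0 : Ed d → ℝ} (hβ0 : IsAdmissibleBump d β0) :
    HasCompactSupport (annularBump β0) :=
  hβ0.2.1.sub (hβ0.2.1.comp_smul two_ne_zero)

theorem annularBump_eq_zero {β0 : Ed d → ℝ} (hβ0 : IsAdmissibleBump d β0) {η : Ed d}
    (hη : ‖η‖ < 1 / 2) : annularBump β0 η = 0 := by
  have h2 : ‖(2 : ℝ) • η‖ ≤ 1 := by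
    rw [norm_smul, Real.norm_two]
    linarith
  rw [annularBump, hβ0.2.2.2.1 η (by linarith), hβ0.2.2.2.1 _ h2, sub_self]

/-- The radial derivative of the bump function. -/
def radialDeriv (β : Ed d → ℝ) (η : Ed d) : ℝ :=
  fderiv ℝ β η η

theorem contDiff_radialDeriv {β : Ed d → ℝ} (hβ : ContDiff ℝ (⊤ : ℕ∞) β) :
    ContDiff ℝ (⊤ : ℕ∞) (radialDeriv β) :=
  (hβ.fderiv_right (m := (⊤ : ℕ∞)) (by simp)).clm_apply contDiff_id

theorem hasCompactSupport_radialDeriv {β : Ed d → ℝ} (hβ : HasCompactSupport β) :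
    HasCompactSupport (radialDeriv β) :=
  (hβ.fderiv ℝ).mono fun η hη => by
    contrapose! hη
    simp_all [radialDeriv]

theorem radialDeriv_eq_zero {β : Ed d → ℝ} (hβ : ∀ η, ‖η‖ < 1 / 2 → β η = 0) {η : Ed d}
    (hη : ‖η‖ < 1 / 2) : radialDeriv β η = 0 := by
  have h : β =ᶠ[𝓝 η] fun _ => 0 := by
    filter_upwards [continuous_norm.continuousAt.eventually_lt_const hη] with ζ hζ
    exact hβ ζ hζ
  rw [radialDeriv, h.fderiv_eq, fderiv_fun_const]
  rfl

/-- The `i`-th coordinate, as a complex-valued function. -/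
def coordC (i : Fin d) (y : Ed d) : ℂ :=
  (⟪EuclideanSpace.basisFun (Fin d) ℝ i, y⟫ : ℂ)

theorem contDiff_coordC (i : Fin d) : ContDiff ℝ (⊤ : ℕ∞) (coordC i) :=
  ofRealCLM.contDiff.comp (contDiff_const.inner ℝ contDiff_id)

theorem isAnnular_ofReal {β : Ed d → ℝ} (hβ : ContDiff ℝ (⊤ : ℕ∞) β) (hβc : HasCompactSupport β)
    (hβ0 : ∀ η, ‖η‖ < 1 / 2 → β η = 0) : IsAnnular fun η => (β η : ℂ) :=
  ⟨ofRealCLM.contDiff.comp hβ, hβc.comp_left (g := ofReal) ofReal_zero, fun η hη => by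
    simp only [hβ0 η hη, ofReal_zero]⟩

theorem IsAnnular.contDiff_mul {a b : Ed d → ℂ} (ha : ContDiff ℝ (⊤ : ℕ∞) a) (hb : IsAnnular b) :
    IsAnnular fun η => a η * b η :=
  ⟨ha.mul hb.1, hb.2.1.mul_left, fun η hη => by simp only [hb.2.2 η hη, mul_zero]⟩

theorem isAnnular_annularBump {β0 : Ed d → ℝ} (hβ0 : IsAdmissibleBump d β0) :
    IsAnnular fun η => (annularBump β0 η : ℂ) :=
  isAnnular_ofReal (contDiff_annularBump hβ0) (hasCompactSupport_annularBump hβ0)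
    fun _ => annularBump_eq_zero hβ0

theorem isAnnular_coordC_mul_annularBump {β0 : Ed d → ℝ} (hβ0 : IsAdmissibleBump d β0) (i : Fin d) :
    IsAnnular fun η => -(2 * Real.pi * I) * coordC i η * annularBump β0 η :=
  IsAnnular.contDiff_mul (contDiff_const.mul (contDiff_coordC i)) (isAnnular_annularBump hβ0)

theorem isAnnular_radialDeriv_annularBump {β0 : Ed d → ℝ} (hβ0 : IsAdmissibleBump d β0) :
    IsAnnular fun η => (radialDeriv (annularBump β0) η : ℂ) :=
  isAnnular_ofReal (contDiff_radialDeriv (contDiff_annularBump hβ0))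
    (hasCompactSupport_radialDeriv (hasCompactSupport_annularBump hβ0))
    fun _ => radialDeriv_eq_zero fun _ => annularBump_eq_zero hβ0

/-- The derivative in `t` of the symbol `\widehat{dσ}(tξ) β(cξ)`, with `c` proportional to `t`. -/
def symbolDeriv (β : Ed d → ℝ) (c t : ℝ) (ξ : Ed d) : ℂ :=
  sphereFourier (fun y => -I * ⟪(2 * Real.pi) • ξ, y⟫) ((2 * Real.pi * t) • ξ) * β ((c * t) • ξ) +
    sphereFourier (fun _ => 1) ((2 * Real.pi * t) • ξ) * (fderiv ℝ β ((c * t) • ξ) (c • ξ) : ℝ)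

theorem hasDerivAt_localizedSymbol (hd : 2 ≤ d) {β : Ed d → ℝ} (hβ : Differentiable ℝ β)
    (c t : ℝ) (ξ : Ed d) :
    HasDerivAt (fun t => localizedSymbol (fun _ => 1) (fun η => (β η : ℂ)) t (c * t) ξ)
      (symbolDeriv β c t ξ) t := by
  have h1 := hasDerivAt_sphereFourier hd (w := fun _ => 1) continuous_const 0 ((2 * Real.pi) • ξ) t
  have h2 : HasDerivAt (fun t : ℝ => (c * t) • ξ) (c • ξ) t := by
    simpa using ((hasDerivAt_id t).const_mul c).smul_const ξ
  have h3 := ((hβ ((c * t) • ξ)).hasFDerivAt.comp_hasDerivAt t h2).ofReal_comp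
  simp only [zero_add, mul_one, smul_smul, mul_comm _ (2 * Real.pi)] at h1
  exact h1.mul h3

theorem norm_symbolDeriv_le (hd : 2 ≤ d) {β : Ed d → ℝ} {M M' : ℝ} (hM : ∀ η, ‖β η‖ ≤ M)
    (hM' : ∀ η, ‖fderiv ℝ β η‖ ≤ M') (c t : ℝ) (ξ : Ed d) :
    ‖symbolDeriv β c t ξ‖ ≤ (2 * Real.pi * M + |c| * M') * ‖ξ‖ := by
  have h1 : ‖sphereFourier (fun y => -I * ⟪(2 * Real.pi) • ξ, y⟫) ((2 * Real.pi * t) • ξ)‖ ≤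
      2 * Real.pi * ‖ξ‖ := norm_sphereFourier_le hd (fun y hy => by
    rw [norm_mul, norm_neg, norm_I, one_mul, norm_real]
    refine (norm_inner_le_norm _ _).trans ?_
    rw [hy, mul_one, norm_smul, Real.norm_of_nonneg (by positivity)]) _
  have h2 : ‖sphereFourier (fun _ => 1) ((2 * Real.pi * t) • ξ)‖ ≤ 1 :=
    norm_sphereFourier_le hd (by simp) _
  have h3 : ‖fderiv ℝ β ((c * t) • ξ) (c • ξ)‖ ≤ M' * (|c| * ‖ξ‖) :=
    (ContinuousLinearMap.le_opNorm _ _).trans (by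
      rw [norm_smul, Real.norm_eq_abs]
      gcongr
      exact hM' _)
  have hM0 : 0 ≤ M := (norm_nonneg _).trans (hM 0)
  refine (norm_add_le _ _).trans ?_
  rw [norm_mul, norm_mul, norm_real, norm_real]
  calc _ ≤ 2 * Real.pi * ‖ξ‖ * M + 1 * (M' * (|c| * ‖ξ‖)) := by
        gcongr
        exact hM _
    _ = _ := by ring

theorem symbolDeriv_eq (hd : 2 ≤ d) (β : Ed d → ℝ) {c t : ℝ} (hc : c ≠ 0) (ht : t ≠ 0)
    (ξ : Ed d) :
    symbolDeriv β c t ξ =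
      ((c * t)⁻¹ : ℝ) * ∑ i, localizedSymbol (coordC i)
        (fun η => -(2 * Real.pi * I) * coordC i η * β η) t (c * t) ξ +
      (t⁻¹ : ℝ) * localizedSymbol (fun _ => 1) (fun η => (radialDeriv β η : ℂ)) t (c * t) ξ := by
  have hct : ((c * t : ℝ) : ℂ) ≠ 0 := ofReal_ne_zero.2 (mul_ne_zero hc ht)
  have hsum : sphereFourier (fun y => -I * ⟪(2 * Real.pi) • ξ, y⟫) ((2 * Real.pi * t) • ξ) =
      ∑ i, -(2 * Real.pi * I) * coordC i ξ * sphereFourier (coordC i) ((2 * Real.pi * t) • ξ) := by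
    simp only [← sphereFourier_const_mul]
    simp only [sphereFourier]
    rw [← integral_finsetSum _ fun i _ => integrable_sphereMeasure_of_continuous hd (by
      have := (contDiff_coordC i).continuous
      fun_prop)]
    refine integral_congr_ae (Eventually.of_forall fun y => ?_)
    have h := (EuclideanSpace.basisFun (Fin d) ℝ).sum_inner_mul_inner ξ y
    simp only [← Finset.mul_sum, mul_assoc]
    congr 1
    rw [real_inner_smul_left, ← h]
    simp only [coordC, real_inner_comm ξ]
    push_cast
    simp only [Finset.mul_sum]
    refine Finset.sum_congr rfl fun i _ => ?_
    ring
  have hrad : radialDeriv β ((c * t) • ξ) = t * fderiv ℝ β ((c * t) • ξ) (c • ξ) := by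
    rw [radialDeriv, mul_comm c t, mul_smul, map_smul, smul_eq_mul]
  have hcoord : ∀ i, coordC i ((c * t) • ξ) = (c * t : ℝ) * coordC i ξ := fun i => by
    rw [coordC, coordC, real_inner_smul_right, ofReal_mul]
  simp only [symbolDeriv, localizedSymbol, hsum, hrad, hcoord, Finset.sum_mul, Finset.mul_sum]
  congr 1
  · refine Finset.sum_congr rfl fun i _ => ?_
    rw [ofReal_inv]
    generalize ((c * t : ℝ) : ℂ) = z at hct ⊢
    field_simp
  · have : (t : ℂ) ≠ 0 := ofReal_ne_zero.2 ht
    rw [ofReal_inv, ofReal_mul]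
    field_simp

theorem Aj_eq_multiplierOp (β0 : Ed d → ℝ) (j : ℕ) (t : ℝ) (f : Ed d → ℂ) :
    Aj d β0 j t f = multiplierOp (localizedSymbol (fun _ => 1) (fun η => (annularBump β0 η : ℂ)) t
      ((2 : ℝ) ^ (-(j : ℤ)) * t)) f := by
  ext x
  refine integral_congr_ae (Eventually.of_forall fun ξ => ?_)
  have h1 : sigmaHat d (t • ξ) = sphereFourier (fun _ => 1) ((2 * Real.pi * t) • ξ) := by
    rw [sigmaHat_eq, sphereFourier]
    simp only [mul_one, real_inner_smul_left, mul_assoc]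
  have h2 : betaJ d β0 j (t • ξ) = annularBump β0 (((2 : ℝ) ^ (-(j : ℤ)) * t) • ξ) := by
    rw [betaJ, annularBump, smul_smul, smul_smul, smul_smul, sub_eq_add_neg (1 : ℤ),
      zpow_add₀ two_ne_zero, zpow_one, mul_assoc]
  simp only [h1, h2, localizedSymbol]

theorem Bj_eq_multiplierOp (hd : 2 ≤ d) {β0 : Ed d → ℝ} (hβ0 : IsAdmissibleBump d β0) (j : ℕ)
    {t : ℝ} (ht : 0 < t) (f : 𝓢(Ed d, ℂ)) :
    Bj d β0 j t f =
      ((2 : ℝ) ^ (-(j : ℤ)) * t)⁻¹ • ∑ i, multiplierOp (localizedSymbol (coordC i)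
        (fun η => -(2 * Real.pi * I) * coordC i η * annularBump β0 η) t
          ((2 : ℝ) ^ (-(j : ℤ)) * t)) f +
      t⁻¹ • multiplierOp (localizedSymbol (fun _ => 1)
        (fun η => (radialDeriv (annularBump β0) η : ℂ)) t ((2 : ℝ) ^ (-(j : ℤ)) * t)) f := by
  ext x
  set c : ℝ := (2 : ℝ) ^ (-(j : ℤ))
  have hc : 0 < c := by positivity
  have hβ := contDiff_annularBump hβ0
  have hβc := hasCompactSupport_annularBump hβ0
  obtain ⟨M, hM⟩ := hβc.exists_bound_of_continuous hβ.continuous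
  obtain ⟨M', hM'⟩ := (hβc.fderiv ℝ).exists_bound_of_continuous
    (hβ.continuous_fderiv (by simp))
  have hint : ∀ {w b : Ed d → ℂ}, Continuous w → IsAnnular b → ∀ s : ℝ, 0 < s →
      Integrable fun ξ => eChar (2 * Real.pi * ⟪ξ, x⟫) * (localizedSymbol w b s (c * s) ξ * fourierInt d f ξ) := by
    intro w b hw hb s hs
    obtain ⟨m, hm⟩ := exists_schwartzMap_eq_localizedSymbol hd hw hb.1 hb.2.1 s (mul_pos hc hs).ne'
    rw [← hm]
    exact integrable_multiplierOp_integrand m f x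
  have hi1 := fun i => hint (contDiff_coordC i).continuous (isAnnular_coordC_mul_annularBump hβ0 i) t ht
  have hi2 := hint (w := fun _ => 1) continuous_const (isAnnular_radialDeriv_annularBump hβ0) t ht
  have hsplit : (fun ξ => eChar (2 * Real.pi * ⟪ξ, x⟫) *
      (symbolDeriv (annularBump β0) c t ξ * fourierInt d f ξ)) = fun ξ =>
      ((c * t)⁻¹ : ℝ) * ∑ i, eChar (2 * Real.pi * ⟪ξ, x⟫) * (localizedSymbol (coordC i)
        (fun η => -(2 * Real.pi * I) * coordC i η * annularBump β0 η) t (c * t) ξ *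
          fourierInt d f ξ) +
      (t⁻¹ : ℝ) * (eChar (2 * Real.pi * ⟪ξ, x⟫) * (localizedSymbol (fun _ => 1)
        (fun η => (radialDeriv (annularBump β0) η : ℂ)) t (c * t) ξ * fourierInt d f ξ)) := by
    ext ξ
    rw [symbolDeriv_eq hd _ hc.ne' ht.ne', ← Finset.mul_sum, ← Finset.sum_mul]
    ring
  have hsum := integrable_finsetSum Finset.univ fun i _ => hi1 i
  have hF' : Integrable fun ξ => eChar (2 * Real.pi * ⟪ξ, x⟫) *
      (symbolDeriv (annularBump β0) c t ξ * fourierInt d f ξ) := by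
    rw [hsplit]
    exact (hsum.const_mul _).add (hi2.const_mul _)
  have hderiv := (hasDerivAt_integral_of_dominated_loc_of_deriv_le (μ := volume) (x₀ := t)
    (F := fun s ξ => eChar (2 * Real.pi * ⟪ξ, x⟫) * (localizedSymbol (fun _ => 1)
      (fun η => (annularBump β0 η : ℂ)) s (c * s) ξ * fourierInt d f ξ))
    (F' := fun s ξ => eChar (2 * Real.pi * ⟪ξ, x⟫) *
      (symbolDeriv (annularBump β0) c s ξ * fourierInt d f ξ))
    (bound := fun ξ => (2 * Real.pi * M + |c| * M') * (‖ξ‖ ^ 1 * ‖fourierInt d f ξ‖))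
    (s := univ) univ_mem ?_ ?_ hF'.1 ?_ ?_ ?_).2
  · have hAj : ∀ s, Aj d β0 j s f x = ∫ ξ, eChar (2 * Real.pi * ⟪ξ, x⟫) *
        (localizedSymbol (fun _ => 1) (fun η => (annularBump β0 η : ℂ)) s (c * s) ξ *
          fourierInt d f ξ) := fun s => by
      rw [Aj_eq_multiplierOp]
      rfl
    simp only [Bj, hAj]
    rw [hderiv.deriv, hsplit, integral_add (hsum.const_mul _) (hi2.const_mul _),
      integral_const_mul, integral_const_mul, integral_finsetSum _ fun i _ => hi1 i]
    simp only [Pi.add_apply, Pi.smul_apply, Finset.sum_apply, real_smul]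
    rfl
  · filter_upwards [lt_mem_nhds ht] with s hs
    exact (hint continuous_const (isAnnular_annularBump hβ0) s hs).1
  · exact hint continuous_const (isAnnular_annularBump hβ0) t ht
  · refine Eventually.of_forall fun ξ s _ => ?_
    rw [norm_mul, norm_eChar, one_mul, norm_mul, pow_one, ← mul_assoc]
    gcongr
    exact norm_symbolDeriv_le hd hM hM' c s ξ
  · rw [fourierInt_eq]
    exact ((FourierTransform.fourier f : 𝓢(Ed d, ℂ)).integrable_pow_mul volume 1).const_mul _
  · refine Eventually.of_forall fun ξ s _ => ?_
    exact ((hasDerivAt_localizedSymbol hd (hβ.differentiable (by simp)) c s ξ).mul_const _).const_mul _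

theorem aestronglyMeasurable_multiplierOp_localizedSymbol (hd : 2 ≤ d) {w b : Ed d → ℂ}
    (hw : Continuous w) (hb : IsAnnular b) (t : ℝ) {s : ℝ} (hs : s ≠ 0) (f : 𝓢(Ed d, ℂ)) :
    AEStronglyMeasurable (multiplierOp (localizedSymbol w b t s) f) volume := by
  obtain ⟨m, hm⟩ := exists_schwartzMap_eq_localizedSymbol hd hw hb.1 hb.2.1 t hs
  rw [← hm, multiplierOp_eq_convolution]
  exact (SchwartzMap.continuous _).aestronglyMeasurable

theorem norm_coordC_le (i : Fin d) {y : Ed d} (hy : ‖y‖ = 1) : ‖coordC i y‖ ≤ 1 := by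
  rw [coordC, norm_real]
  refine (norm_inner_le_norm _ _).trans ?_
  rw [hy, OrthonormalBasis.norm_eq_one, one_mul]

end Assembly

/-- Lemma 2.1 (ii): `L^p` bounds for `A_t^j` and `B_t^j`, `1 ≤ p ≤ 2`;
here `1/p' = 1 - 1/p`. -/
theorem Aj_Lp_bound (d : ℕ) (hd : 2 ≤ d) (β0 : Ed d → ℝ)
    (hβ0 : IsAdmissibleBump d β0) (p : ℝ) (hp1 : 1 ≤ p) (hp2 : p ≤ 2) :
    ∃ C : ℝ, 0 < C ∧ ∀ (k : ℤ) (j : ℕ), 10 ≤ j →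
      ∀ t : ℝ, t ∈ Set.Icc ((2:ℝ) ^ k) ((2:ℝ) ^ (k + 1)) →
      ∀ f : SchwartzMap (Ed d) ℂ,
        eLpNorm (fun x => Aj d β0 j t (⇑f) x) (ENNReal.ofReal p) volume +
            ENNReal.ofReal ((2:ℝ) ^ (k - (j:ℤ))) *
              eLpNorm (fun x => Bj d β0 j t (⇑f) x) (ENNReal.ofReal p) volume ≤
          ENNReal.ofReal (C * (2:ℝ) ^ (-(j:ℝ) * ((d:ℝ) - 1) * (1 - 1 / p))) *
            eLpNorm (⇑f) (ENNReal.ofReal p) volume := by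
  have hp : 1 ≤ ENNReal.ofReal p := by rwa [ENNReal.one_le_ofReal]
  obtain ⟨C₁, hC₁, hbound₁⟩ := exists_eLpNorm_multiplierOp_localizedSymbol_le hd hp1 hp2
    continuous_const (by simp) (sphereFourier_one_decay hd) (isAnnular_annularBump hβ0)
  obtain ⟨C₂, hC₂, hbound₂⟩ := exists_eLpNorm_multiplierOp_localizedSymbol_le hd hp1 hp2
    continuous_const (by simp) (sphereFourier_one_decay hd) (isAnnular_radialDeriv_annularBump hβ0)
  choose C₃ hC₃ hbound₃ using fun i => exists_eLpNorm_multiplierOp_localizedSymbol_le hd hp1 hp2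
    (contDiff_coordC i).continuous (fun _ => norm_coordC_le i)
    (sphereFourier_inner_decay hd ((EuclideanSpace.basisFun (Fin d) ℝ).norm_eq_one i))
    (isAnnular_coordC_mul_annularBump hβ0 i)
  have hC₃sum : 0 ≤ ∑ i, C₃ i := Finset.sum_nonneg fun i _ => (hC₃ i).le
  refine ⟨C₁ + ((∑ i, C₃ i) + C₂), by positivity, fun k j _ t ht f => ?_⟩
  have h2k : (0 : ℝ) < 2 ^ k := by positivity
  have ht0 : 0 < t := h2k.trans_le ht.1
  have hc : (0 : ℝ) < 2 ^ (-(j : ℤ)) := by positivity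
  have hct : 0 < (2 : ℝ) ^ (-(j : ℤ)) * t := mul_pos hc ht0
  set R : ℝ := (2:ℝ) ^ (-(j:ℝ) * ((d:ℝ) - 1) * (1 - 1 / p))
  have hR : (t / ((2 : ℝ) ^ (-(j : ℤ)) * t)) ^ (-((d : ℝ) - 1) * (1 - 1 / p)) = R := by
    rw [div_mul_cancel_right₀ ht0.ne', zpow_neg, inv_inv, zpow_natCast, ← Real.rpow_natCast,
      ← Real.rpow_mul zero_le_two]
    congr 1
    ring
  have hR0 : 0 < R := by positivity
  have hA := hbound₁ t _ ht0 hct f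
  have hB₂ := hbound₂ t _ ht0 hct f
  have hB₃ := fun i => hbound₃ i t _ ht0 hct f
  rw [hR] at hA hB₂
  simp only [hR] at hB₃
  rw [← Aj_eq_multiplierOp] at hA
  have hscale₁ : ENNReal.ofReal ((2 : ℝ) ^ (k - (j : ℤ))) * ‖((2 : ℝ) ^ (-(j : ℤ)) * t)⁻¹‖ₑ ≤ 1 := by
    rw [Real.enorm_eq_ofReal (by positivity), ← ENNReal.ofReal_mul (by positivity),
      ENNReal.ofReal_le_one, ← div_eq_mul_inv, div_le_one hct, sub_eq_add_neg,
      zpow_add₀ two_ne_zero, mul_comm]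
    gcongr
    exact ht.1
  have hscale₂ : ENNReal.ofReal ((2 : ℝ) ^ (k - (j : ℤ))) * ‖t⁻¹‖ₑ ≤ 1 := by
    rw [Real.enorm_eq_ofReal (by positivity), ← ENNReal.ofReal_mul (by positivity),
      ENNReal.ofReal_le_one, ← div_eq_mul_inv, div_le_one ht0]
    refine le_trans ?_ ht.1
    gcongr
    · exact one_le_two
    · lia
  have hm₃ := fun i => aestronglyMeasurable_multiplierOp_localizedSymbol hd
    (contDiff_coordC i).continuous (isAnnular_coordC_mul_annularBump hβ0 i) t hct.ne' f
  have hB : ENNReal.ofReal ((2:ℝ) ^ (k - (j:ℤ))) * eLpNorm (Bj d β0 j t f) (ENNReal.ofReal p) volume ≤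
      ENNReal.ofReal (((∑ i, C₃ i) + C₂) * R) * eLpNorm f (ENNReal.ofReal p) volume := by
    rw [Bj_eq_multiplierOp hd hβ0 j ht0 f]
    refine (mul_le_mul_right (eLpNorm_add_le
      ((Finset.aestronglyMeasurable_sum _ fun i _ => hm₃ i).const_smul _)
      ((aestronglyMeasurable_multiplierOp_localizedSymbol hd continuous_const
        (isAnnular_radialDeriv_annularBump hβ0) t hct.ne' f).const_smul _) hp) _).trans ?_
    rw [eLpNorm_const_smul, eLpNorm_const_smul, mul_add, ← mul_assoc, ← mul_assoc, add_mul (∑ i, C₃ i),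
      ENNReal.ofReal_add (by positivity) (by positivity), add_mul, Finset.sum_mul,
      ENNReal.ofReal_sum_of_nonneg fun i _ => mul_nonneg (hC₃ i).le hR0.le, Finset.sum_mul]
    refine add_le_add ?_ ?_
    · exact (mul_le_of_le_one_left' hscale₁).trans ((eLpNorm_sum_le (fun i _ => hm₃ i) hp).trans
        (Finset.sum_le_sum fun i _ => hB₃ i))
    · exact (mul_le_of_le_one_left' hscale₂).trans hB₂
  rw [add_mul C₁, ENNReal.ofReal_add (by positivity) (by positivity), add_mul]
  exact add_le_add hA hB
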